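/- Let X ⊆ ℝ^n and Y ⊆ ℝ^m be unbounded semialgebraic sets and let h : X → Y be a semialgebraic bijection such that (1/K)‖x₁ − x₂‖ ≤ ‖h(x₁) − h(x₂)‖ ≤ K‖x₁ − x₂‖ for all x₁, x₂ ∈ X, for some K ≥ 1. Then for every v ∈ C(X,∞) there is a unique w ∈ C(Y,∞), denoted d_∞h(v), such that for every continuous semialgebraic arc γ : (ε,∞) → X with γ(t) = t·v + o_∞(t) one has h(γ(t)) = t·w + o_∞(t); moreover the map d_∞h : C(X,∞) → C(Y,∞) is a bijection satisfying (1/K)‖v₁ − v₂‖ ≤ ‖d_∞h(v₁) − d_∞h(v₂)‖ ≤ K‖v₁ − v₂‖ for all v₁, v₂ ∈ C(X,∞). -/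

import Mathlib

open Filter Set Topology

noncomputable section

section TopDefs

variable {α β : Type*} [TopologicalSpace α] [TopologicalSpace β]

/-- `h` restricts to a homeomorphism from `X` onto `Y` (for the subspace topologies). -/
def IsHomeoOn (h : α → β) (X : Set α) (Y : Set β) : Prop :=
  Set.BijOn h X Y ∧ ContinuousOn h X ∧
    ∃ g : β → α, (∀ x ∈ X, g (h x) = x) ∧ (∀ y ∈ Y, h (g y) = y) ∧ ContinuousOn g Y

/-- `A` is a topological manifold of dimension `d` (charts onto open subsets of `ℝ^d`). -/
def IsTopManifoldOfDim (A : Set α) (d : ℕ) : Prop :=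
  ∀ a ∈ A, ∃ W : Set α, IsOpen W ∧ a ∈ W ∧
    ∃ (U : Set (EuclideanSpace ℝ (Fin d))) (f : α → EuclideanSpace ℝ (Fin d)),
      IsOpen U ∧ IsHomeoOn f (A ∩ W) U

/-- The model half-space in `ℝ^d`. -/
def halfSpace (d : ℕ) : Set (EuclideanSpace ℝ (Fin d)) :=
  {u | ∀ hd : 0 < d, 0 ≤ u ⟨0, hd⟩}

/-- `A` is a topological manifold with boundary of dimension `d`
(charts onto relatively open subsets of the half-space of `ℝ^d`). -/
def IsTopManifoldWithBoundaryOfDim (A : Set α) (d : ℕ) : Prop :=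
  ∀ a ∈ A, ∃ W : Set α, IsOpen W ∧ a ∈ W ∧
    ∃ (V : Set (EuclideanSpace ℝ (Fin d))) (f : α → EuclideanSpace ℝ (Fin d)),
      IsOpen V ∧ IsHomeoOn f (A ∩ W) (V ∩ halfSpace d)

end TopDefs

section BlowSpherical

variable {E F : Type*} [NormedAddCommGroup E] [NormedSpace ℝ E]
  [NormedAddCommGroup F] [NormedSpace ℝ F]

/-- The inverse of the spherical blow-up at `p`, `x ↦ ((x-p)/‖x-p‖, ‖x-p‖)`. -/
def blowupInv (p x : E) : E × ℝ := (‖x - p‖⁻¹ • (x - p), ‖x - p‖)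

/-- The inverse of the spherical blow-up at infinity, `x ↦ (x/‖x‖, 1/‖x‖)`. -/
def blowupInvInf (x : E) : E × ℝ := (‖x‖⁻¹ • x, ‖x‖⁻¹)

/-- The strict transform of `X` under the spherical blow-up at `p`. -/
def strictTransform (X : Set E) (p : E) : Set (E × ℝ) := closure (blowupInv p '' (X \ {p}))

/-- The strict transform of `X` under the spherical blow-up at infinity. -/
def strictTransformInf (X : Set E) : Set (E × ℝ) := closure (blowupInvInf '' (X \ {0}))

/-- The strict transform at `p ∈ E ∪ {∞}`, where `none` stands for `∞`. -/
def strictTransformO (X : Set E) : Option E → Set (E × ℝ)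
  | some p => strictTransform X p
  | none => strictTransformInf X

/-- The boundary of a strict transform: the points with second coordinate `0`. -/
def transformBoundary (T : Set (E × ℝ)) : Set (E × ℝ) := {z ∈ T | z.2 = 0}

/-- The filter of neighbourhoods of infinity within `X`. -/
def atInftyOn (X : Set E) : Filter E :=
  Filter.comap (fun x : E => ‖x‖) Filter.atTop ⊓ Filter.principal X

/-- `q = lim_{x → p} h(x)` where `p ∈ E ∪ {∞}`, `q ∈ F ∪ {∞}` (`none` stands for `∞`). -/
def BSLimit (h : E → F) (X : Set E) : Option E → Option F → Prop
  | some p, some q => Filter.Tendsto h (nhdsWithin p X) (nhds q)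
  | some p, none => Filter.Tendsto (fun x => ‖h x‖) (nhdsWithin p X) Filter.atTop
  | none, some q => Filter.Tendsto h (atInftyOn X) (nhds q)
  | none, none => Filter.Tendsto (fun x => ‖h x‖) (atInftyOn X) Filter.atTop

/-- The inverse of the spherical blow-up at `p ∈ E ∪ {∞}`. -/
def blowupInvO : Option E → E → E × ℝ
  | some p, x => blowupInv p x
  | none, x => blowupInvInf x

/-- `x` is the center of the spherical blow-up at `p ∈ E ∪ {∞}` (at infinity, the center is `0`). -/
def IsCenter : Option E → E → Prop
  | some p, x => x = p
  | none, x => x = 0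

/-- `h` is a blow-spherical homeomorphism from `X` onto `Y` at `p ∈ E ∪ {∞}` (with
`q = lim_{x → p} h(x) ∈ F ∪ {∞}`): `h` is a homeomorphism from `X` onto `Y` and the induced map
between the strict transforms extends to a homeomorphism `Φ` of the strict transforms. -/
def IsBSHomeoAtO (h : E → F) (X : Set E) (Y : Set F) (po : Option E) (qo : Option F) : Prop :=
  IsHomeoOn h X Y ∧ BSLimit h X po qo ∧
    ∃ Φ : E × ℝ → F × ℝ,
      IsHomeoOn Φ (strictTransformO X po) (strictTransformO Y qo) ∧
      ∀ x ∈ X, ¬ IsCenter po x → ¬ IsCenter qo (h x) →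
        Φ (blowupInvO po x) = blowupInvO qo (h x)

/-- `h` is a (global) blow-spherical homeomorphism from `X` onto `Y`: it is a blow-spherical
homeomorphism at every `p ∈ closure X ∪ {∞}`. -/
def IsBSHomeo (h : E → F) (X : Set E) (Y : Set F) : Prop :=
  IsHomeoOn h X Y ∧
    (∀ p ∈ closure X, ∃ qo : Option F, IsBSHomeoAtO h X Y (some p) qo) ∧
    (∃ qo : Option F, IsBSHomeoAtO h X Y none qo)

/-- `X` and `Y` are blow-spherical homeomorphic at infinity: outside suitable compact sets there
is a homeomorphism which is blow-spherical at `∞`. -/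
def BSHomeoAtInfinity (X : Set E) (Y : Set F) : Prop :=
  ∃ (K : Set E) (K' : Set F), IsCompact K ∧ IsCompact K' ∧
    ∃ h : E → F, IsBSHomeoAtO h (X \ K) (Y \ K') none none

/-- The tangent cone of `X` at `p`. -/
def tangConeAt (X : Set E) (p : E) : Set E :=
  {v | ∃ (x : ℕ → E) (t : ℕ → ℝ), (∀ i, x i ∈ X) ∧ (∀ i, 0 < t i) ∧
    Filter.Tendsto x Filter.atTop (nhds p) ∧
    Filter.Tendsto (fun i => (t i)⁻¹ • (x i - p)) Filter.atTop (nhds v)}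

/-- The tangent cone of `X` at infinity. -/
def tangConeInf (X : Set E) : Set E :=
  {v | ∃ (x : ℕ → E) (t : ℕ → ℝ), (∀ i, x i ∈ X) ∧ (∀ i, 0 < t i) ∧
    Filter.Tendsto (fun i => ‖x i‖) Filter.atTop Filter.atTop ∧
    Filter.Tendsto (fun i => (t i)⁻¹ • x i) Filter.atTop (nhds v)}

/-- The tangent cone of `X` at `p ∈ E ∪ {∞}`. -/
def tangConeO (X : Set E) : Option E → Set E
  | some p => tangConeAt X p
  | none => tangConeInf X

/-- `Cone_∞(A) = {t • a : a ∈ A, t ≥ 1}`. -/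
def coneInfSet (A : Set E) : Set E := {y | ∃ a ∈ A, ∃ t : ℝ, 1 ≤ t ∧ y = t • a}

/-- The inner distance on `X`: the infimum of lengths of paths in `X` joining `x` to `y`. -/
def innerDist (X : Set E) (x y : E) : ENNReal :=
  ⨅ (γ : ℝ → E) (_ : ContinuousOn γ (Set.Icc 0 1)) (_ : Set.MapsTo γ (Set.Icc 0 1) X)
    (_ : γ 0 = x) (_ : γ 1 = y), eVariationOn γ (Set.Icc 0 1)

/-- `X` is Lipschitz normally embedded. -/
def IsLNE (X : Set E) : Prop :=
  ∃ c : ℝ, 1 ≤ c ∧ ∀ x ∈ X, ∀ y ∈ X, innerDist X x y ≤ ENNReal.ofReal (c * ‖x - y‖)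

/-- `X` is Lipschitz normally embedded at the point `p`. -/
def IsLNEAt (X : Set E) (p : E) : Prop := ∃ U : Set E, IsOpen U ∧ p ∈ U ∧ IsLNE (X ∩ U)

/-- `X` is Lipschitz normally embedded at infinity. -/
def IsLNEAtInf (X : Set E) : Prop := ∃ K : Set E, IsCompact K ∧ IsLNE (X \ K)

/-- `X` and `Y` are outer lipeomorphic. -/
def OuterLipeo (X : Set E) (Y : Set F) : Prop :=
  ∃ (h : E → F) (lam : ℝ), 1 ≤ lam ∧ Set.BijOn h X Y ∧
    ∀ x ∈ X, ∀ x' ∈ X, lam⁻¹ * ‖x - x'‖ ≤ ‖h x - h x'‖ ∧ ‖h x - h x'‖ ≤ lam * ‖x - x'‖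

/-- `X` and `Y` are outer lipeomorphic at infinity. -/
def OuterLipeoAtInf (X : Set E) (Y : Set F) : Prop :=
  ∃ (K : Set E) (K' : Set F), IsCompact K ∧ IsCompact K' ∧ OuterLipeo (X \ K) (Y \ K')

/-- The ends of `C` relative to `R`: the connected components of `C \ {‖x‖ ≤ R}`. -/
def endsRel (C : Set E) (R : ℝ) : Set (Set E) :=
  {A | ∃ x ∈ C \ Metric.closedBall 0 R, A = connectedComponentIn (C \ Metric.closedBall 0 R) x}

/-- `X` contains a homeomorphic copy of a nonempty open subset of `ℝ^d`. -/
def HasDimGE (X : Set E) (d : ℕ) : Prop :=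
  ∃ (U : Set (EuclideanSpace ℝ (Fin d))) (f : EuclideanSpace ℝ (Fin d) → E),
    IsOpen U ∧ U.Nonempty ∧ f '' U ⊆ X ∧ IsHomeoOn f U (f '' U)

/-- `X` has (topological) dimension `d`. -/
def HasDim (X : Set E) (d : ℕ) : Prop := HasDimGE X d ∧ ¬ HasDimGE X (d + 1)

/-- `x` is a simple point of the boundary of the strict transform `T`, relative to dimension `d`:
near `x`, the connected components of `T` minus the boundary are `d`-dimensional topological
manifolds, and together with the boundary they are topological manifolds with boundary. -/
def IsSimplePointOf (T : Set (E × ℝ)) (d : ℕ) (x : E × ℝ) : Prop :=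
  x ∈ transformBoundary T ∧
    ∃ W : Set (E × ℝ), IsOpen W ∧ x ∈ W ∧
      ∀ y ∈ (T ∩ W) \ transformBoundary T,
        IsTopManifoldOfDim (connectedComponentIn ((T ∩ W) \ transformBoundary T) y) d ∧
        IsTopManifoldWithBoundaryOfDim
          (connectedComponentIn ((T ∩ W) \ transformBoundary T) y ∪ (transformBoundary T ∩ W)) d

/-- `x` is a simple point of the boundary of the strict transform `T` of the set `X`. -/
def IsSimplePoint (X : Set E) (T : Set (E × ℝ)) (x : E × ℝ) : Prop :=
  ∃ d : ℕ, HasDim X d ∧ IsSimplePointOf T d x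

/-- The relative multiplicity: for every sufficiently small open neighbourhood `W` of `x`,
the number of connected components of `(T \ ∂T) ∩ W` whose closure contains `x` equals `k`. -/
def RelMultAt (T : Set (E × ℝ)) (x : E × ℝ) (k : ℕ) : Prop :=
  ∃ W₀ : Set (E × ℝ), IsOpen W₀ ∧ x ∈ W₀ ∧
    ∀ W : Set (E × ℝ), IsOpen W → x ∈ W → W ⊆ W₀ →
      {C : Set (E × ℝ) |
        (∃ y ∈ (T \ transformBoundary T) ∩ W,
          C = connectedComponentIn ((T \ transformBoundary T) ∩ W) y) ∧
        x ∈ closure C}.ncard = k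

/-- The relative multiplicity of the end `A` (at infinity) equals `k`: the relative multiplicity
equals `k` on a dense open subset of the boundary of the strict transform at infinity of `A`. -/
def EndMult (A : Set E) (k : ℕ) : Prop :=
  ∃ U : Set (E × ℝ), IsOpen U ∧
    transformBoundary (strictTransformInf A) ⊆
      closure (transformBoundary (strictTransformInf A) ∩ U) ∧
    ∀ x ∈ transformBoundary (strictTransformInf A) ∩ U, RelMultAt (strictTransformInf A) x k

end BlowSpherical

section Algebraic

/-- `X ⊆ ℝ^n` is semialgebraic. -/
def IsSemialgebraic {n : ℕ} (X : Set (EuclideanSpace ℝ (Fin n))) : Prop :=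
  ∃ (m : ℕ) (P : Fin m → MvPolynomial (Fin n) ℝ) (k : Fin m → ℕ)
    (Q : (i : Fin m) → Fin (k i) → MvPolynomial (Fin n) ℝ),
    X = ⋃ i, {x | MvPolynomial.eval (fun j => x j) (P i) = 0 ∧
      ∀ l, 0 < MvPolynomial.eval (fun j => x j) (Q i l)}

/-- The map `h` is semialgebraic on `X`: its graph over `X` is a semialgebraic set. -/
def IsSemialgebraicMapOn {n m : ℕ} (h : EuclideanSpace ℝ (Fin n) → EuclideanSpace ℝ (Fin m))
    (X : Set (EuclideanSpace ℝ (Fin n))) : Prop :=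
  IsSemialgebraic { z : EuclideanSpace ℝ (Fin (n + m)) |
    ∃ x ∈ X, (∀ i : Fin n, z (Fin.castAdd m i) = x i) ∧ ∀ j : Fin m, z (Fin.natAdd n j) = h x j }

/-- `γ` is a continuous semialgebraic arc on `(ε, ∞)`. -/
def IsSemialgebraicArc {n : ℕ} (γ : ℝ → EuclideanSpace ℝ (Fin n)) (ε : ℝ) : Prop :=
  ContinuousOn γ (Set.Ioi ε) ∧
  IsSemialgebraic { z : EuclideanSpace ℝ (Fin (1 + n)) |
    ∃ t ∈ Set.Ioi ε, z (Fin.castAdd n 0) = t ∧ ∀ j : Fin n, z (Fin.natAdd 1 j) = γ t j }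

/-- `X ⊆ ℂ^n` is a complex algebraic set. -/
def IsComplexAlgebraic {n : ℕ} (X : Set (EuclideanSpace ℂ (Fin n))) : Prop :=
  ∃ (m : ℕ) (P : Fin m → MvPolynomial (Fin n) ℂ),
    X = {x | ∀ i, MvPolynomial.eval (fun j => x j) (P i) = 0}

/-- `X` is an irreducible complex algebraic set. -/
def IsIrreducibleAlg {n : ℕ} (X : Set (EuclideanSpace ℂ (Fin n))) : Prop :=
  X.Nonempty ∧ IsComplexAlgebraic X ∧
    ∀ A B : Set (EuclideanSpace ℂ (Fin n)),
      IsComplexAlgebraic A → IsComplexAlgebraic B → X = A ∪ B → X = A ∨ X = B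

/-- `C` is an irreducible component of `X`: a maximal irreducible algebraic subset of `X`. -/
def IsIrredComponent {n : ℕ} (C X : Set (EuclideanSpace ℂ (Fin n))) : Prop :=
  IsIrreducibleAlg C ∧ C ⊆ X ∧
    ∀ C' : Set (EuclideanSpace ℂ (Fin n)), IsIrreducibleAlg C' → C' ⊆ X → C ⊆ C' → C = C'

/-- The (Krull) dimension of the algebraic set `C` equals `d`: there is a strictly increasing
chain of `d+1` irreducible algebraic sets ending in `C`, and no such chain of `d+2` sets. -/
def HasAlgDim {n : ℕ} (C : Set (EuclideanSpace ℂ (Fin n))) (d : ℕ) : Prop :=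
  (∃ f : Fin (d + 1) → Set (EuclideanSpace ℂ (Fin n)),
    (∀ i, IsIrreducibleAlg (f i)) ∧ StrictMono f ∧ f (Fin.last d) = C) ∧
  ¬ ∃ f : Fin (d + 2) → Set (EuclideanSpace ℂ (Fin n)),
    (∀ i, IsIrreducibleAlg (f i)) ∧ StrictMono f ∧ f (Fin.last (d + 1)) = C

/-- `X ⊆ ℂ^n` is a complex algebraic curve: a nonempty complex algebraic set all of whose
irreducible components have complex dimension 1. -/
def IsComplexAlgebraicCurve {n : ℕ} (X : Set (EuclideanSpace ℂ (Fin n))) : Prop :=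
  IsComplexAlgebraic X ∧ X.Nonempty ∧ ∀ C, IsIrredComponent C X → HasAlgDim C 1

/-- `X ⊆ ℂ^n` is a pure dimensional complex algebraic set. -/
def IsPureDimComplexAlgebraic {n : ℕ} (X : Set (EuclideanSpace ℂ (Fin n))) : Prop :=
  IsComplexAlgebraic X ∧ X.Nonempty ∧ ∃ d, ∀ C, IsIrredComponent C X → HasAlgDim C d

/-- `S` is a 1-dimensional complex submanifold: locally the image of a holomorphic embedding,
with nowhere-vanishing derivative, of an open subset of `ℂ`. -/
def IsOneDimComplexSubmanifold {n : ℕ} (S : Set (EuclideanSpace ℂ (Fin n))) : Prop :=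
  ∀ z ∈ S, ∃ (W : Set (EuclideanSpace ℂ (Fin n))) (V : Set ℂ)
    (f : ℂ → EuclideanSpace ℂ (Fin n)),
    IsOpen W ∧ z ∈ W ∧ IsOpen V ∧ DifferentiableOn ℂ f V ∧ Set.InjOn f V ∧
    (∀ t ∈ V, derivWithin f V t ≠ 0) ∧ f '' V = S ∩ W

/-- The set of singular points of `X ⊆ ℂ^n`. -/
def SingSet {n : ℕ} (X : Set (EuclideanSpace ℂ (Fin n))) : Set (EuclideanSpace ℂ (Fin n)) :=
  {p ∈ X | ¬ ∃ U : Set (EuclideanSpace ℂ (Fin n)), IsOpen U ∧ p ∈ U ∧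
    IsOneDimComplexSubmanifold (X ∩ U)}

/-- The embedding `ι : ℂ^n → ℙ^n(ℂ)`, `x ↦ [1 : x]`. -/
def projIota {n : ℕ} (x : EuclideanSpace ℂ (Fin n)) : Projectivization ℂ (Fin (n + 1) → ℂ) :=
  Projectivization.mk ℂ (Fin.cons 1 (fun j => x j)) (by
    intro hzero
    have h0 := congrFun hzero 0
    simp at h0)

end Algebraic

section SignIso

theorem exists_orderIso_move {l a b u : ℝ} (hl : l < a) (hab : a ≤ b) (hu : b < u) :
    ∃ τ : ℝ ≃o ℝ, τ a = b ∧ ∀ s, s ≤ l ∨ u ≤ s → τ s = s := by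
  have ha : 0 < a - l := by linarith
  have hb : 0 < u - a := by linarith
  set m₁ := (b - l) / (a - l) with hm₁
  set m₂ := (u - b) / (u - a) with hm₂
  have h₁ : 1 ≤ m₁ := by rw [hm₁, le_div_iff₀ ha]; linarith
  have h₂ : m₂ ≤ 1 := by rw [hm₂, div_le_iff₀ hb]; linarith
  have h₂' : 0 < m₂ := div_pos (by linarith) hb
  have e₁ : m₁ * (a - l) = b - l := by rw [hm₁]; field_simp
  have e₂ : m₂ * (u - a) = u - b := by rw [hm₂]; field_simp
  set F : ℝ → ℝ := fun s => max s (min (l + m₁ * (s - l)) (u - m₂ * (u - s))) with hF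
  have hmono : StrictMono F := by
    intro x y hxy
    refine max_lt_max hxy (min_lt_min ?_ ?_)
    · have : m₁ * (x - l) < m₁ * (y - l) := by gcongr
      simpa using this
    · have : m₂ * (u - y) < m₂ * (u - x) := by gcongr
      simpa using this
  have hcont : Continuous F := by fun_prop
  have hfix : ∀ s, s ≤ l ∨ u ≤ s → F s = s := by
    rintro s (hs | hs)
    · refine max_eq_left (min_le_of_left_le ?_)
      nlinarith
    · refine max_eq_left (min_le_of_right_le ?_)
      nlinarith
  have hsurj : Function.Surjective F := by
    refine hcont.surjective ?_ ?_
    · exact tendsto_atTop_mono (fun s => le_max_left _ _) tendsto_id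
    · refine tendsto_id.congr' ?_
      filter_upwards [eventually_le_atBot l] with s hs using (hfix s (.inl hs)).symm
  refine ⟨hmono.orderIsoOfSurjective F hsurj, ?_, hfix⟩
  simp only [StrictMono.coe_orderIsoOfSurjective, hF, e₁, e₂]
  simp [hab]

theorem Finset.exists_lt_forall_le_of_lt (Z : Finset ℝ) (m : ℝ) :
    ∃ l < m, ∀ z ∈ Z, z < m → z ≤ l := by
  have h : ∀ᶠ l in 𝓝[<] m, ∀ z ∈ Z, z < m → z ≤ l := by
    refine (Finset.eventually_all Z).2 fun z _ => ?_
    by_cases hz : z < m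
    · filter_upwards [Ioo_mem_nhdsLT hz] with l hl _ using hl.1.le
    · exact Eventually.of_forall fun _ h => absurd h hz
  obtain ⟨l, h₁, h₂⟩ := (h.and self_mem_nhdsWithin).exists
  exact ⟨l, h₂, h₁⟩

theorem Finset.exists_gt_forall_ge_of_gt (Z : Finset ℝ) (m : ℝ) :
    ∃ u > m, ∀ z ∈ Z, m < z → u ≤ z := by
  have h : ∀ᶠ u in 𝓝[>] m, ∀ z ∈ Z, m < z → u ≤ z := by
    refine (Finset.eventually_all Z).2 fun z _ => ?_
    by_cases hz : m < z
    · filter_upwards [Ioo_mem_nhdsGT hz] with l hl _ using hl.2.le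
    · exact Eventually.of_forall fun _ h => absurd h hz
  obtain ⟨l, h₁, h₂⟩ := (h.and self_mem_nhdsWithin).exists
  exact ⟨l, h₂, h₁⟩

/-- An increasing bijection of the line can be modified, without changing it on a finite set, so
that it takes a prescribed value at one more point. -/
theorem exists_orderIso_extend (φ : ℝ ≃o ℝ) (Z : Finset ℝ) {x y : ℝ}
    (h : ∀ z ∈ Z, (z < x ∧ φ z < y) ∨ (x < z ∧ y < φ z)) :
    ∃ ψ : ℝ ≃o ℝ, (∀ z ∈ Z, ψ z = φ z) ∧ ψ x = y := by
  classical
  obtain ⟨l, hl, hl'⟩ := (Z.image φ).exists_lt_forall_le_of_lt (min (φ x) y)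
  obtain ⟨u, hu, hu'⟩ := (Z.image φ).exists_gt_forall_ge_of_gt (max (φ x) y)
  have key : ∀ z ∈ Z, φ z ≤ l ∨ u ≤ φ z := by
    intro z hz
    rcases h z hz with ⟨h₁, h₂⟩ | ⟨h₁, h₂⟩
    · exact .inl (hl' _ (Finset.mem_image_of_mem _ hz) (lt_min (φ.lt_iff_lt.2 h₁) h₂))
    · exact .inr (hu' _ (Finset.mem_image_of_mem _ hz) (max_lt (φ.lt_iff_lt.2 h₁) h₂))
  rw [lt_min_iff] at hl
  rw [gt_iff_lt, max_lt_iff] at hu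
  rcases le_total (φ x) y with hxy | hxy
  · obtain ⟨τ, h₁, h₂⟩ := exists_orderIso_move hl.1 hxy hu.2
    exact ⟨φ.trans τ, fun z hz => h₂ _ (key z hz), h₁⟩
  · obtain ⟨τ, h₁, h₂⟩ := exists_orderIso_move hl.2 hxy hu.1
    refine ⟨φ.trans τ.symm, fun z hz => ?_, ?_⟩
    · rw [OrderIso.trans_apply, OrderIso.symm_apply_eq, h₂ _ (key z hz)]
    · rw [OrderIso.trans_apply, OrderIso.symm_apply_eq, h₁]

theorem Finset.exists_adjacent (Z : Finset ℝ) {x l₀ u₀ : ℝ} (hx : x ∉ Z) (hl₀ : l₀ ∈ Z)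
    (hu₀ : u₀ ∈ Z) (hl : l₀ < x) (hu : x < u₀) :
    ∃ l ∈ Z, ∃ u ∈ Z, l < x ∧ x < u ∧ ∀ z ∈ Z, z ≤ l ∨ u ≤ z := by
  obtain ⟨l, hlm, hlmax⟩ := (Z.filter (· < x)).exists_max_image id ⟨l₀, by simp [*]⟩
  obtain ⟨u, hum, humin⟩ := (Z.filter (x < ·)).exists_min_image id ⟨u₀, by simp [*]⟩
  simp only [Finset.mem_filter, id] at hlm hum hlmax humin
  refine ⟨l, hlm.1, u, hum.1, hlm.2, hum.2, fun z hz => ?_⟩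
  rcases lt_trichotomy z x with h | h | h
  · exact .inl (hlmax z ⟨hz, h⟩)
  · exact absurd (h ▸ hz) hx
  · exact .inr (humin z ⟨hz, h⟩)

/-- If the signs of `f` and `g ∘ ψ` agree at the endpoints of an interval where `g ∘ ψ` is strictly
increasing, the signs agree on it as soon as `ψ` maps zeros of `f` to zeros of `g`. -/
theorem sign_eq_of_strictMonoOn {f g : ℝ → ℝ} (hf : Continuous f) {ψ : ℝ ≃o ℝ} {l u x : ℝ}
    (hlx : l < x) (hxu : x < u)
    (hmg : StrictMonoOn g (Icc (ψ l) (ψ u)))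
    (hsl : SignType.sign (f l) = SignType.sign (g (ψ l)))
    (hsu : SignType.sign (f u) = SignType.sign (g (ψ u)))
    (hroot : ∀ r, f r = 0 → g (ψ r) = 0) :
    SignType.sign (f x) = SignType.sign (g (ψ x)) := by
  have hlx' := ψ.lt_iff_lt.2 hlx
  have hxu' := ψ.lt_iff_lt.2 hxu
  rcases lt_trichotomy (f x) 0 with h | h | h
  · rw [sign_neg h]
    by_contra hne
    have hg : 0 ≤ g (ψ x) := by
      by_contra! hg
      exact hne (sign_neg hg).symm
    have hgu : 0 < g (ψ u) := hg.trans_lt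
      (hmg ⟨hlx'.le, hxu'.le⟩ ⟨(hlx'.trans hxu').le, le_rfl⟩ hxu')
    rw [sign_pos hgu, sign_eq_one_iff] at hsu
    obtain ⟨r, hr, hr0⟩ := intermediate_value_Ioo hxu.le hf.continuousOn ⟨h, hsu⟩
    have := hmg ⟨hlx'.le, hxu'.le⟩ ⟨(hlx'.trans (ψ.lt_iff_lt.2 hr.1)).le,
      (ψ.lt_iff_lt.2 hr.2).le⟩ (ψ.lt_iff_lt.2 hr.1)
    rw [hroot r hr0] at this
    linarith
  · rw [h, hroot x h]
  · rw [sign_pos h]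
    by_contra hne
    have hg : g (ψ x) ≤ 0 := by
      by_contra! hg
      exact hne (sign_pos hg).symm
    have hgl : g (ψ l) < 0 := (hmg ⟨le_rfl, (hlx'.trans hxu').le⟩ ⟨hlx'.le, hxu'.le⟩
      hlx').trans_le hg
    rw [sign_neg hgl, sign_eq_neg_one_iff] at hsl
    obtain ⟨r, hr, hr0⟩ := intermediate_value_Ioo hlx.le hf.continuousOn ⟨hsl, h⟩
    have := hmg ⟨(ψ.lt_iff_lt.2 hr.1).le, ((ψ.lt_iff_lt.2 hr.2).trans hxu').le⟩
      ⟨hlx'.le, hxu'.le⟩ (ψ.lt_iff_lt.2 hr.2)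
    rw [hroot r hr0] at this
    linarith

/-- A strictly monotone function with a zero inside an interval changes sign there, and so does
any continuous function with the same signs at corresponding endpoints. -/
theorem exists_zero_of_sign_eq {f g : ℝ → ℝ} (hg : Continuous g) {l x u l' u' : ℝ}
    (hlx : l < x) (hxu : x < u) (hlu' : l' < u')
    (hmf : StrictMonoOn f (Icc l u) ∨ StrictAntiOn f (Icc l u))
    (hsl : SignType.sign (f l) = SignType.sign (g l'))
    (hsu : SignType.sign (f u) = SignType.sign (g u')) (hx : f x = 0) :
    ∃ y ∈ Ioo l' u', g y = 0 := by
  have hl : l ∈ Icc l u := ⟨le_rfl, (hlx.trans hxu).le⟩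
  have hu : u ∈ Icc l u := ⟨(hlx.trans hxu).le, le_rfl⟩
  have hxm : x ∈ Icc l u := ⟨hlx.le, hxu.le⟩
  rcases hmf with hm | hm
  · have h₁ := hm hl hxm hlx
    have h₂ := hm hxm hu hxu
    rw [hx] at h₁ h₂
    rw [sign_neg h₁, eq_comm, sign_eq_neg_one_iff] at hsl
    rw [sign_pos h₂, eq_comm, sign_eq_one_iff] at hsu
    exact intermediate_value_Ioo hlu'.le hg.continuousOn ⟨hsl, hsu⟩
  · have h₁ := hm hl hxm hlx
    have h₂ := hm hxm hu hxu
    rw [hx] at h₁ h₂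
    rw [sign_pos h₁, eq_comm, sign_eq_one_iff] at hsl
    rw [sign_neg h₂, eq_comm, sign_eq_neg_one_iff] at hsu
    exact intermediate_value_Ioo' hlu'.le hg.continuousOn ⟨hsu, hsl⟩

/-- If `f` and `g` are piecewise strictly monotone along a finite set `Z` and its image `φ '' Z`,
with the same directions, the same signs on `Z` and near `±∞`, then `φ` can be modified off `Z` so
as to match the signs of `f` and `g` everywhere. -/
theorem exists_orderIso_sign_eq {f g : ℝ → ℝ} (hf : Continuous f) (hg : Continuous g)
    (φ : ℝ ≃o ℝ) (Z : Finset ℝ)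
    (hZ : ∀ z ∈ Z, SignType.sign (f z) = SignType.sign (g (φ z)))
    (hmono : ∀ l u, l < u → (∀ z ∈ Z, z ≤ l ∨ u ≤ z) →
      (StrictMonoOn f (Icc l u) ∧ StrictMonoOn g (Icc (φ l) (φ u))) ∨
      (StrictAntiOn f (Icc l u) ∧ StrictAntiOn g (Icc (φ l) (φ u))))
    (hfin : {x | f x = 0}.Finite)
    {σ σ' : SignType} (hσ : σ ≠ 0) (hσ' : σ' ≠ 0) (hfT : ∀ᶠ x in atTop, SignType.sign (f x) = σ)
    (hgT : ∀ᶠ x in atTop, SignType.sign (g x) = σ)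
    (hfB : ∀ᶠ x in atBot, SignType.sign (f x) = σ')
    (hgB : ∀ᶠ x in atBot, SignType.sign (g x) = σ') :
    ∃ ψ : ℝ ≃o ℝ, (∀ z ∈ Z, ψ z = φ z) ∧
      ∀ x, SignType.sign (f x) = SignType.sign (g (ψ x)) := by
  classical
  obtain ⟨U, hfU, hgU⟩ : ∃ U, (∀ x ≥ U, SignType.sign (f x) = σ) ∧
      ∀ y ≥ φ U, SignType.sign (g y) = σ := by
    obtain ⟨U₁, h₁⟩ := eventually_atTop.1 hfT
    obtain ⟨U₂, h₂⟩ := eventually_atTop.1 hgT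
    exact ⟨max U₁ (φ.symm U₂), fun x hx => h₁ x (le_of_max_le_left hx), fun y hy => h₂ y
      ((φ.symm_apply_le.1 (le_max_right U₁ (φ.symm U₂))).trans hy)⟩
  obtain ⟨L, hfL, hgL⟩ : ∃ L, (∀ x ≤ L, SignType.sign (f x) = σ') ∧
      ∀ y ≤ φ L, SignType.sign (g y) = σ' := by
    obtain ⟨U₁, h₁⟩ := eventually_atBot.1 hfB
    obtain ⟨U₂, h₂⟩ := eventually_atBot.1 hgB
    exact ⟨min U₁ (φ.symm U₂), fun x hx => h₁ x (le_min_iff.1 hx).1, fun y hy => h₂ y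
      (hy.trans (φ.le_symm_apply.1 (min_le_right U₁ (φ.symm U₂))))⟩
  wlog hLU : L ∈ Z ∧ U ∈ Z generalizing Z
  · obtain ⟨ψ, h₁, h₂⟩ := this (insert L (insert U Z)) (by
      intro z hz
      simp only [Finset.mem_insert] at hz
      rcases hz with rfl | rfl | hz
      · rw [hfL _ le_rfl, hgL _ le_rfl]
      · rw [hfU _ le_rfl, hgU _ le_rfl]
      · exact hZ z hz)
      (fun l u hlu h => hmono l u hlu fun z hz => h z (by simp [hz])) (by simp)
    exact ⟨ψ, fun z hz => h₁ z (by simp [hz]), h₂⟩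
  obtain ⟨hLZ, hUZ⟩ := hLU
  have adj : ∀ x ∉ Z, L < x → x < U → ∃ l ∈ Z, ∃ u ∈ Z, l < x ∧ x < u ∧ ∀ z ∈ Z, z ≤ l ∨ u ≤ z :=
    fun x hx h₁ h₂ => Z.exists_adjacent hx hLZ hUZ h₁ h₂
  have hroot : ∀ x, f x = 0 → L < x ∧ x < U := by
    intro x hx
    constructor <;> by_contra! h
    · exact hσ' (by rw [← hfL x h, hx, sign_zero])
    · exact hσ (by rw [← hfU x h, hx, sign_zero])
  obtain ⟨ψ, hψZ, hψ⟩ : ∃ ψ : ℝ ≃o ℝ, (∀ z ∈ Z, ψ z = φ z) ∧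
      ∀ r ∈ hfin.toFinset, g (ψ r) = 0 := by
    have hR : ∀ r ∈ hfin.toFinset, f r = 0 := fun r hr => by simpa using hr
    generalize hfin.toFinset = R at hR
    induction R using Finset.induction_on with
    | empty => exact ⟨φ, fun _ _ => rfl, by simp⟩
    | insert x R hxR ih =>
      obtain ⟨ψ, hψZ, hψ⟩ := ih fun r hr => hR r (by simp [hr])
      have hx := hR x (by simp)
      by_cases hxZ : x ∈ Z
      · refine ⟨ψ, hψZ, fun r hr => ?_⟩
        rcases Finset.mem_insert.1 hr with rfl | hr
        · have := hZ r hxZ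
          rw [hx, sign_zero, eq_comm, sign_eq_zero_iff] at this
          rw [hψZ r hxZ, this]
        · exact hψ r hr
      obtain ⟨l, hl, u, hu, hlx, hxu, hlu⟩ := adj x hxZ (hroot x hx).1 (hroot x hx).2
      obtain ⟨y, hy, hy0⟩ := exists_zero_of_sign_eq hg hlx hxu (φ.lt_iff_lt.2 (hlx.trans hxu))
        ((hmono l u (hlx.trans hxu) hlu).imp And.left And.left) (hZ l hl) (hZ u hu) hx
      have hsep : ∀ z ∈ Z, (z < x ∧ φ z < y) ∨ (x < z ∧ y < φ z) := by
        intro z hz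
        rcases hlu z hz with h | h
        · exact .inl ⟨h.trans_lt hlx, (φ.le_iff_le.2 h).trans_lt hy.1⟩
        · exact .inr ⟨hxu.trans_le h, hy.2.trans_le (φ.le_iff_le.2 h)⟩
      have hbetween : ∀ a b, a < b → f a = 0 → f b = 0 → ∃ z ∈ Z, a < z ∧ z < b := by
        intro a b hab ha hb
        by_contra! hcon
        have h₁ : a ∈ Icc a b := ⟨le_rfl, hab.le⟩
        have h₂ : b ∈ Icc a b := ⟨hab.le, le_rfl⟩
        rcases hmono a b hab fun z hz => (le_or_gt z a).imp_right (hcon z hz) with h | h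
        · exact (h.1 h₁ h₂ hab).ne (ha.trans hb.symm)
        · exact (h.1 h₁ h₂ hab).ne (hb.trans ha.symm)
      obtain ⟨ψ', h₁, h₂⟩ := exists_orderIso_extend ψ (Z ∪ R) (x := x) (y := y) (by
        intro r hr
        rcases Finset.mem_union.1 hr with hr | hr
        · rw [hψZ r hr]
          exact hsep r hr
        have hr0 := hR r (by simp [hr])
        rcases lt_trichotomy r x with h | h | h
        · obtain ⟨z, hz, h₁, h₂⟩ := hbetween r x h hr0 hx
          refine .inl ⟨h, ((ψ.lt_iff_lt.2 h₁).trans_eq (hψZ z hz)).trans ?_⟩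
          rcases hsep z hz with h | h
          · exact h.2
          · exact absurd h.1 h₂.asymm
        · exact absurd (h ▸ hr) hxR
        · obtain ⟨z, hz, h₁, h₂⟩ := hbetween x r h hx hr0
          refine .inr ⟨h, lt_trans ?_ ((hψZ z hz).symm.trans_lt (ψ.lt_iff_lt.2 h₂))⟩
          rcases hsep z hz with h | h
          · exact absurd h.1 h₁.asymm
          · exact h.2)
      refine ⟨ψ', fun z hz => (h₁ z (by simp [hz])).trans (hψZ z hz), fun r hr => ?_⟩
      rcases Finset.mem_insert.1 hr with rfl | hr
      · rw [h₂, hy0]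
      · rw [h₁ r (by simp [hr]), hψ r hr]
  have hψ' : ∀ r, f r = 0 → g (ψ r) = 0 := fun r hr => hψ r (by simpa using hr)
  refine ⟨ψ, hψZ, fun x => ?_⟩
  by_cases hxZ : x ∈ Z
  · rw [hψZ x hxZ, hZ x hxZ]
  rcases le_or_gt x L with hxL | hxL
  · rw [hfL x hxL, hgL _ ((ψ.le_iff_le.2 hxL).trans_eq (hψZ L hLZ))]
  rcases le_or_gt U x with hxU | hxU
  · rw [hfU x hxU, hgU _ ((hψZ U hUZ).symm.trans_le (ψ.le_iff_le.2 hxU))]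
  obtain ⟨l, hl, u, hu, hlx, hxu, hlu⟩ := adj x hxZ hxL hxU
  have hsl := hZ l hl
  have hsu := hZ u hu
  have hm := hmono l u (hlx.trans hxu) hlu
  rw [← hψZ l hl] at hsl hm
  rw [← hψZ u hu] at hsu hm
  rcases hm with h | h
  · exact sign_eq_of_strictMonoOn hf hlx hxu h.2 hsl hsu hψ'
  · have := sign_eq_of_strictMonoOn (f := fun y => -f y) (g := fun y => -g y) hf.neg hlx hxu h.2.neg
      (by rw [Left.sign_neg, Left.sign_neg, hsl]) (by rw [Left.sign_neg, Left.sign_neg, hsu])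
      (fun r hr => by rw [hψ' r (neg_eq_zero.1 hr), neg_zero])
    rwa [Left.sign_neg, Left.sign_neg, neg_inj] at this
end SignIso

section SignDiagram

open Polynomial

theorem Polynomial.sign_eval_eq_of_forall_ne_zero (p : ℝ[X]) {x y : ℝ}
    (h : ∀ z ∈ uIcc x y, p.eval z ≠ 0) :
    SignType.sign (p.eval x) = SignType.sign (p.eval y) := by
  by_contra hne
  have hx := h x left_mem_uIcc
  have hy := h y right_mem_uIcc
  have h0 : (0 : ℝ) ∈ uIcc (p.eval x) (p.eval y) := by
    rw [mem_uIcc]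
    rcases lt_or_gt_of_ne hx with hx | hx <;> rcases lt_or_gt_of_ne hy with hy | hy <;>
      simp_all [sign_neg, sign_pos] <;> grind
  obtain ⟨z, hz, hz0⟩ := intermediate_value_uIcc p.continuous.continuousOn h0
  exact h z hz hz0

theorem Polynomial.eventually_sign_eval_atTop {p : ℝ[X]} (hp : p ≠ 0) :
    ∀ᶠ x in atTop, SignType.sign (p.eval x) = SignType.sign p.leadingCoeff := by
  have key : ∀ q : ℝ[X], 0 < q.leadingCoeff → ∀ᶠ x in atTop, 0 < q.eval x := by
    intro q hq
    rcases le_or_gt q.degree 0 with hd | hd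
    · rw [eq_C_of_degree_le_zero hd] at hq ⊢
      exact Eventually.of_forall fun x => by simpa using hq
    · exact (q.tendsto_atTop_of_leadingCoeff_nonneg hd hq.le).eventually_gt_atTop 0
  rcases lt_or_gt_of_ne (leadingCoeff_ne_zero.2 hp) with h | h
  · filter_upwards [key (-p) (by simpa using h)] with x hx
    rw [sign_neg h, sign_neg (by simpa using hx)]
  · filter_upwards [key p h] with x hx
    rw [sign_pos h, sign_pos hx]

theorem Polynomial.eventually_sign_eval_atBot {p : ℝ[X]} (hp : p ≠ 0) :
    ∀ᶠ x in atBot, SignType.sign (p.eval x) =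
      SignType.sign ((-1) ^ p.natDegree * p.leadingCoeff) := by
  have h : p.comp (-X) ≠ 0 := by simpa [comp_neg_X_eq_zero_iff] using hp
  have := tendsto_neg_atBot_atTop.eventually (eventually_sign_eval_atTop h)
  simpa using this

theorem Polynomial.exists_even_pow_mul_eq_mul_add {A : Type*} [CommRing A] {g : A[X]} {k : ℕ}
    (hk : 0 < k) (hg : g.natDegree ≤ k) (f : A[X]) :
    ∃ (N : ℕ) (q r : A[X]), C (g.coeff k) ^ (2 * N) * f = q * g + r ∧ r.natDegree < k := by
  induction h : f.natDegree using Nat.strong_induction_on generalizing f with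
  | _ n ih =>
    by_cases hn : n < k
    · exact ⟨0, 0, f, by simp, h ▸ hn⟩
    push Not at hn
    set c := g.coeff k
    set f₁ := C c * f - C (f.coeff n) * X ^ (n - k) * g with hf₁
    have hdeg : f₁.natDegree < n := by
      have hle : f₁.natDegree ≤ n := by
        refine (natDegree_sub_le _ _).trans (max_le ?_ ?_)
        · exact (natDegree_C_mul_le _ _).trans h.le
        · refine natDegree_mul_le.trans ?_
          have := natDegree_C_mul_X_pow_le (f.coeff n) (n - k)
          omega
      refine lt_of_le_of_ne hle fun heq => ?_
      have h0 : f₁.coeff n = 0 := by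
        have : (C (f.coeff n) * X ^ (n - k) * g).coeff n = f.coeff n * c := by
          rw [mul_assoc, coeff_C_mul, coeff_X_pow_mul', if_pos (Nat.sub_le n k),
            Nat.sub_sub_self hn]
        rw [hf₁, coeff_sub, coeff_C_mul, this]
        ring
      have : f₁ = 0 := by
        rw [← leadingCoeff_eq_zero, leadingCoeff, heq, h0]
      rw [this, natDegree_zero] at heq
      omega
    obtain ⟨N, q, r, hqr, hr⟩ := ih _ hdeg f₁ rfl
    refine ⟨N + 1, C c * q + C c ^ (2 * N + 1) * C (f.coeff n) * X ^ (n - k), C c * r, ?_,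
      (natDegree_C_mul_le _ _).trans_lt hr⟩
    have : C c * (C c ^ (2 * N) * f₁) = C c * (q * g + r) := by rw [hqr]
    rw [hf₁] at this
    linear_combination this

theorem Polynomial.strictMonoOn_or_strictAntiOn {p : ℝ[X]} {l u : ℝ}
    (h : ∀ z ∈ Ioo l u, p.derivative.eval z ≠ 0) (hlu : l < u) :
    ((∀ z ∈ Ioo l u, 0 < p.derivative.eval z) ∧ StrictMonoOn (fun x => p.eval x) (Icc l u)) ∨
    ((∀ z ∈ Ioo l u, p.derivative.eval z < 0) ∧ StrictAntiOn (fun x => p.eval x) (Icc l u)) := by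
  have hm : (l + u) / 2 ∈ Ioo l u := ⟨by linarith, by linarith⟩
  have hs : ∀ z ∈ Ioo l u, SignType.sign (p.derivative.eval z) =
      SignType.sign (p.derivative.eval ((l + u) / 2)) := fun z hz =>
    sign_eval_eq_of_forall_ne_zero _ fun w hw => h w (ordConnected_Ioo.uIcc_subset hz hm hw)
  rcases lt_or_gt_of_ne (h _ hm) with h0 | h0
  · right
    have hneg : ∀ z ∈ Ioo l u, p.derivative.eval z < 0 := fun z hz => by
      rw [← sign_eq_neg_one_iff, hs z hz, sign_neg h0]
    refine ⟨hneg, strictAntiOn_of_deriv_neg (convex_Icc l u) p.continuous.continuousOn ?_⟩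
    simpa [interior_Icc, Polynomial.deriv] using hneg
  · left
    have hpos : ∀ z ∈ Ioo l u, 0 < p.derivative.eval z := fun z hz => by
      rw [← sign_eq_one_iff, hs z hz, sign_pos h0]
    refine ⟨hpos, strictMonoOn_of_deriv_pos (convex_Icc l u) p.continuous.continuousOn ?_⟩
    simpa [interior_Icc, Polynomial.deriv] using hpos

/-- The sign diagrams of `F` at `a` and at `b` coincide. -/
def SameSignDiagram {A : Type*} [CommRing A] (F : Set A[X]) (a b : A →+* ℝ) (φ : ℝ ≃o ℝ) : Prop :=
  ∀ f ∈ F, ∀ x, SignType.sign ((f.map a).eval x) = SignType.sign ((f.map b).eval (φ x))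

theorem sign_eval_eq_of_root {A : Type*} [CommRing A] {a b : A →+* ℝ} {f g q r : A[X]} {c : A}
    {N : ℕ} (h : C c ^ (2 * N) * f = q * g + r) (hca : a c ≠ 0) (hcb : b c ≠ 0) {x y : ℝ}
    (hx : (g.map a).eval x = 0) (hy : (g.map b).eval y = 0)
    (hr : SignType.sign ((r.map a).eval x) = SignType.sign ((r.map b).eval y)) :
    SignType.sign ((f.map a).eval x) = SignType.sign ((f.map b).eval y) := by
  have key : ∀ (e : A →+* ℝ) (t : ℝ), e c ≠ 0 → (g.map e).eval t = 0 →
      SignType.sign ((f.map e).eval t) = SignType.sign ((r.map e).eval t) := by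
    intro e t hc ht
    have := congrArg (fun p => (p.map e).eval t) h
    simp only [Polynomial.map_mul, Polynomial.map_pow, map_C, Polynomial.map_add, eval_mul,
      eval_pow, eval_C, eval_add, ht, mul_zero, zero_add] at this
    have hpos : 0 < e c ^ (2 * N) := by
      rw [pow_mul]
      positivity
    rw [← this, sign_mul, sign_pos hpos, one_mul]
  rw [key a x hca hx, key b y hcb hy, hr]

/-- The inductive step for sign diagrams at two points where the leading coefficient of `f` does
not vanish. -/
theorem SameSignDiagram.exists_insert {A : Type*} [CommRing A] {a b : A →+* ℝ} {φ : ℝ ≃o ℝ}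
    {H : Finset A[X]} {f : A[X]} {d : ℕ} (hd : 0 < d) (hfd : f.natDegree = d)
    (hφ : SameSignDiagram (H : Set A[X]) a b φ) (hder : f.derivative ∈ H)
    (hroot : ∀ g ∈ H, g.map a ≠ 0 → ∀ x, (g.map a).eval x = 0 →
      SignType.sign ((f.map a).eval x) = SignType.sign ((f.map b).eval (φ x)))
    (hc : a (f.coeff d) ≠ 0)
    (hsc : SignType.sign (a (f.coeff d)) = SignType.sign (b (f.coeff d))) :
    ∃ ψ, SameSignDiagram (insert f (H : Set A[X])) a b ψ := by
  classical
  have hcb : b (f.coeff d) ≠ 0 := by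
    rwa [← sign_ne_zero, ← hsc, sign_ne_zero]
  have deg : ∀ e : A →+* ℝ, e (f.coeff d) ≠ 0 →
      (f.map e).natDegree = d ∧ (f.map e).leadingCoeff = e (f.coeff d) ∧ f.map e ≠ 0 := by
    intro e he
    have h₁ : (f.map e).natDegree = d := by
      refine le_antisymm (natDegree_map_le.trans hfd.le) (le_natDegree_of_ne_zero ?_)
      rwa [coeff_map]
    refine ⟨h₁, by rw [leadingCoeff, h₁, coeff_map], ?_⟩
    rintro h0
    rw [h0, natDegree_zero] at h₁
    omega
  obtain ⟨da, la, na⟩ := deg a hc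
  obtain ⟨db, lb, nb⟩ := deg b hcb
  set Z : Finset ℝ := H.biUnion fun g => (g.map a).roots.toFinset with hZ
  have memZ : ∀ g ∈ H, g.map a ≠ 0 → ∀ x, (g.map a).eval x = 0 → x ∈ Z := by
    intro g hg h0 x hx
    simp only [hZ, Finset.mem_biUnion, Multiset.mem_toFinset]
    exact ⟨g, hg, (mem_roots h0).2 hx⟩
  have hda : f.derivative.map a ≠ 0 := by
    rw [← derivative_map]
    intro h0
    have := derivative_eq_zero.1 h0
    omega
  obtain ⟨ψ, hψZ, hψ⟩ := exists_orderIso_sign_eq (f := fun x => (f.map a).eval x)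
    (g := fun x => (f.map b).eval x) (f.map a).continuous (f.map b).continuous φ Z
    (by
      intro z hz
      simp only [hZ, Finset.mem_biUnion, Multiset.mem_toFinset] at hz
      obtain ⟨g, hg, hz⟩ := hz
      rw [mem_roots'] at hz
      exact hroot g hg hz.1 z hz.2)
    (by
      intro l u hlu h
      have h₁ : ∀ z ∈ Ioo l u, (f.map a).derivative.eval z ≠ 0 := by
        intro z hz h0
        rw [derivative_map] at h0
        rcases h z (memZ _ hder hda z h0) with h | h
        · exact absurd hz.1 h.not_gt
        · exact absurd hz.2 h.not_gt
      have hs : ∀ z, SignType.sign ((f.map a).derivative.eval z) =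
          SignType.sign ((f.map b).derivative.eval (φ z)) := by
        intro z
        rw [derivative_map, derivative_map]
        exact hφ _ hder z
      have h₂ : ∀ z ∈ Ioo (φ l) (φ u), (f.map b).derivative.eval z ≠ 0 := by
        intro z hz
        obtain ⟨z, rfl⟩ := φ.surjective z
        rw [← sign_ne_zero, ← hs z, sign_ne_zero]
        exact h₁ z ⟨φ.lt_iff_lt.1 hz.1, φ.lt_iff_lt.1 hz.2⟩
      have hm : (l + u) / 2 ∈ Ioo l u := ⟨by linarith, by linarith⟩
      have hm' : φ ((l + u) / 2) ∈ Ioo (φ l) (φ u) :=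
        ⟨φ.lt_iff_lt.2 hm.1, φ.lt_iff_lt.2 hm.2⟩
      have hsm := hs ((l + u) / 2)
      rcases strictMonoOn_or_strictAntiOn h₁ hlu with ⟨h₃, h₄⟩ | ⟨h₃, h₄⟩ <;>
        rcases strictMonoOn_or_strictAntiOn h₂ (φ.lt_iff_lt.2 hlu) with ⟨h₅, h₆⟩ | ⟨h₅, h₆⟩
      · exact .inl ⟨h₄, h₆⟩
      · rw [sign_pos (h₃ _ hm), sign_neg (h₅ _ hm')] at hsm
        exact absurd hsm (by decide)
      · rw [sign_neg (h₃ _ hm), sign_pos (h₅ _ hm')] at hsm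
        exact absurd hsm (by decide)
      · exact .inr ⟨h₄, h₆⟩)
    ((f.map a).roots.toFinset.finite_toSet.subset fun x hx => by
      simpa [mem_roots na] using hx)
    (σ := SignType.sign (a (f.coeff d))) (σ' := SignType.sign ((-1) ^ d * a (f.coeff d)))
    (by simpa using hc) (by simpa using hc)
    (by simpa only [la] using eventually_sign_eval_atTop na)
    (by simpa only [lb, hsc] using eventually_sign_eval_atTop nb)
    (by simpa only [la, da] using eventually_sign_eval_atBot na)
    (by simpa only [lb, db, sign_mul, hsc] using eventually_sign_eval_atBot nb)
  refine ⟨ψ, fun g hg x => ?_⟩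
  rcases hg with rfl | hg
  · exact hψ x
  have hx' : SignType.sign ((g.map a).eval x) =
      SignType.sign ((g.map a).eval (φ.symm (ψ x))) := by
    by_cases h0 : g.map a = 0
    · simp [h0]
    by_cases hxZ : x ∈ Z
    · rw [hψZ x hxZ, φ.symm_apply_apply]
    refine sign_eval_eq_of_forall_ne_zero _ fun z hz hz0 => ?_
    have hzZ := memZ g hg h0 z hz0
    have hzx : z ≠ x := fun h => hxZ (h ▸ hzZ)
    have h₁ := hψZ z hzZ
    have e₁ : z < x ↔ z < φ.symm (ψ x) := by
      rw [φ.lt_symm_apply, ← h₁, ψ.lt_iff_lt]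
    have e₂ : x < z ↔ φ.symm (ψ x) < z := by
      rw [φ.symm_apply_lt, ← h₁, ψ.lt_iff_lt]
    rw [mem_uIcc] at hz
    rcases lt_or_gt_of_ne hzx with h | h
    · have := e₁.1 h
      rcases hz with hz | hz <;> linarith
    · have := e₂.1 h
      rcases hz with hz | hz <;> linarith
  rw [hx', hφ g hg, φ.apply_symm_apply]

/-- Tarski's principle: the sign diagram of a finite family of polynomials in one variable, with
coefficients depending on parameters, is determined by the signs of finitely many polynomials in the
parameters. -/
theorem exists_finset_sameSignDiagram {A : Type*} [CommRing A] (F : Finset A[X]) :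
    ∃ P : Finset A, ∀ a b : A →+* ℝ, (∀ p ∈ P, SignType.sign (a p) = SignType.sign (b p)) →
      ∃ φ, SameSignDiagram (F : Set A[X]) a b φ := by
  classical
  suffices h : ∀ d, ∀ F : Finset A[X], (∀ f ∈ F, f.natDegree < d) →
      ∃ P : Finset A, ∀ a b : A →+* ℝ, (∀ p ∈ P, SignType.sign (a p) = SignType.sign (b p)) →
        ∃ φ, SameSignDiagram (F : Set A[X]) a b φ by
    exact h (F.sup natDegree + 1) F fun f hf => Nat.lt_succ_of_le (Finset.le_sup hf)
  intro d
  induction d with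
  | zero =>
    intro F hF
    refine ⟨∅, fun a b _ => ⟨OrderIso.refl ℝ, fun f hf => ?_⟩⟩
    exact absurd (hF f hf) (Nat.not_lt_zero _)
  | succ d ihd =>
    intro F hF
    suffices h : ∀ F₂ F₁ : Finset A[X], (∀ f ∈ F₂, f.natDegree = d) →
        (∀ f ∈ F₁, f.natDegree < d) → ∃ P : Finset A, ∀ a b : A →+* ℝ,
        (∀ p ∈ P, SignType.sign (a p) = SignType.sign (b p)) →
        ∃ φ, SameSignDiagram ((F₂ ∪ F₁ : Finset A[X]) : Set A[X]) a b φ by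
      have := h (F.filter (·.natDegree = d)) (F.filter (·.natDegree < d)) (by simp) (by simp)
      rw [← Finset.filter_or, Finset.filter_true_of_mem] at this
      · exact this
      · intro f hf
        have := hF f hf
        omega
    intro F₂
    induction F₂ using Finset.induction_on with
    | empty =>
      intro F₁ _ hF₁
      simpa using ihd F₁ hF₁
    | insert f F₂ _ ih =>
      intro F₁ hF₂ hF₁
      have hf := hF₂ f (by simp)
      replace hF₂ : ∀ g ∈ F₂, g.natDegree = d := fun g hg => hF₂ g (by simp [hg])
      rcases Nat.eq_zero_or_pos d with rfl | hd
      · obtain ⟨P, hP⟩ := ih F₁ hF₂ hF₁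
        refine ⟨insert (f.coeff 0) P, fun a b hab => ?_⟩
        obtain ⟨φ, hφ⟩ := hP a b fun p hp => hab p (by simp [hp])
        refine ⟨φ, fun g hg x => ?_⟩
        rw [Finset.insert_union, Finset.coe_insert] at hg
        rcases hg with rfl | hg
        · rw [eq_C_of_natDegree_eq_zero hf]
          simpa using hab _ (Finset.mem_insert_self _ _)
        · exact hφ g hg x
      have hprem : ∀ (g : A[X]) (k : ℕ), ∃ r : A[X], 0 < k → r.natDegree < k ∧ ∃ (N : ℕ) (q : A[X]),
          C (g.coeff k) ^ (2 * N) * f = q * (∑ i ∈ Finset.range (k + 1), C (g.coeff i) * X ^ i) + r := by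
        intro g k
        rcases Nat.eq_zero_or_pos k with rfl | hk
        · exact ⟨0, by simp⟩
        have hdeg : (∑ i ∈ Finset.range (k + 1), C (g.coeff i) * X ^ i).natDegree ≤ k := by
          refine natDegree_sum_le_of_forall_le _ _ fun i hi => ?_
          exact (natDegree_C_mul_X_pow_le _ _).trans (Finset.mem_range_succ_iff.1 hi)
        obtain ⟨N, q, r, h₁, h₂⟩ := exists_even_pow_mul_eq_mul_add hk hdeg f
        refine ⟨r, fun _ => ⟨h₂, N, q, ?_⟩⟩
        rw [← h₁]
        simp [coeff_C_mul, coeff_X_pow]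
      choose rem hrem using hprem
      set H : Finset A[X] := insert f.derivative (F₂ ∪ F₁) with hH
      have hHd : ∀ g ∈ H, g.natDegree ≤ d := by
        intro g hg
        simp only [hH, Finset.mem_insert, Finset.mem_union] at hg
        rcases hg with rfl | hg | hg
        · exact (natDegree_derivative_le f).trans (by omega)
        · exact (hF₂ g hg).le
        · exact (hF₁ g hg).le
      set F₁' : Finset A[X] := F₁ ∪ ({f.derivative, f.eraseLead} ∪
        (H ×ˢ Finset.Icc 1 d).image fun s => rem s.1 s.2) with hF₁'
      obtain ⟨P, hP⟩ := ih F₁' hF₂ (by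
        intro g hg
        simp only [hF₁', Finset.mem_union, Finset.mem_insert, Finset.mem_singleton,
          Finset.mem_image, Finset.mem_product, Finset.mem_Icc, Prod.exists] at hg
        rcases hg with hg | (rfl | rfl) | ⟨g, k, ⟨_, hk₁, hk₂⟩, rfl⟩
        · exact hF₁ g hg
        · exact (natDegree_derivative_lt (by omega)).trans_eq hf
        · exact f.eraseLead_natDegree_le.trans_lt (by omega)
        · exact (hrem g k hk₁).1.trans_le hk₂)
      refine ⟨P ∪ insert (f.coeff d) ((H ×ˢ Finset.range (d + 1)).image fun s => s.1.coeff s.2),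
        fun a b hab => ?_⟩
      obtain ⟨φ, hφ⟩ := hP a b fun p hp => hab p (by simp [hp])
      have hfc : SignType.sign (a (f.coeff d)) = SignType.sign (b (f.coeff d)) :=
        hab _ (by simp)
      have hHc : ∀ g ∈ H, ∀ k, SignType.sign (a (g.coeff k)) = SignType.sign (b (g.coeff k)) := by
        intro g hg k
        by_cases hk : k ≤ d
        · refine hab _ (Finset.mem_union_right _ (Finset.mem_insert_of_mem ?_))
          exact Finset.mem_image.2 ⟨(g, k), by simp [hg, Nat.lt_succ_of_le hk], rfl⟩
        · rw [coeff_eq_zero_of_natDegree_lt ((hHd g hg).trans_lt (not_le.1 hk))]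
          simp
      have hφH : SameSignDiagram (H : Set A[X]) a b φ := by
        intro g hg x
        refine hφ g ?_ x
        simp only [hH, Finset.coe_insert, Finset.coe_union, Set.mem_insert_iff, Set.mem_union,
          Finset.mem_coe] at hg
        simp only [Finset.coe_union, hF₁', Finset.coe_insert, Set.mem_union, Finset.mem_coe,
          Set.mem_insert_iff]
        tauto
      by_cases hc : a (f.coeff d) = 0
      · have hcb : b (f.coeff d) = 0 := by
          rwa [← sign_eq_zero_iff, ← hfc, sign_eq_zero_iff]
        refine ⟨φ, fun g hg x => ?_⟩
        rw [Finset.insert_union, Finset.coe_insert] at hg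
        rcases hg with rfl | hg
        · have key : ∀ e : A →+* ℝ, e (g.coeff d) = 0 → g.map e = g.eraseLead.map e := by
            intro e he
            conv_lhs => rw [← g.eraseLead_add_monomial_natDegree_leadingCoeff]
            rw [Polynomial.map_add, map_monomial, leadingCoeff, hf, he, map_zero, add_zero]
          rw [key a hc, key b hcb]
          exact hφ _ (by simp [hF₁']) x
        · exact hφH g (by simp only [hH, Finset.coe_insert]; exact Or.inr hg) x
      · obtain ⟨ψ, hψ⟩ := hφH.exists_insert hd hf (by simp [hH]) (by
          intro g hg hg0 x hx
          set k := (g.map a).natDegree with hk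
          have hck : a (g.coeff k) ≠ 0 := by
            rwa [← coeff_map, hk, coeff_natDegree, leadingCoeff_ne_zero]
          have hckb : b (g.coeff k) ≠ 0 := by
            rwa [← sign_ne_zero, ← hHc g hg k, sign_ne_zero]
          have hkpos : 0 < k := by
            refine Nat.pos_of_ne_zero fun h0 => hck ?_
            rw [eq_C_of_natDegree_eq_zero (hk.symm.trans h0), eval_C, coeff_map] at hx
            rwa [h0]
          have hkd : k ≤ d := natDegree_map_le.trans (hHd g hg)
          have trunc : ∀ e : A →+* ℝ, (∀ i, k < i → e (g.coeff i) = 0) →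
              (∑ i ∈ Finset.range (k + 1), C (g.coeff i) * X ^ i).map e = g.map e := by
            intro e he
            ext i
            simp only [coeff_map, finsetSum_coeff, coeff_C_mul, coeff_X_pow, mul_ite, mul_one,
              mul_zero, Finset.sum_ite_eq, Finset.mem_range]
            split_ifs with hi
            · rfl
            · rw [map_zero, he i (by omega)]
          have ha0 : ∀ i, k < i → a (g.coeff i) = 0 := fun i hi => by
            rw [← coeff_map]
            exact coeff_eq_zero_of_natDegree_lt hi
          have hb0 : ∀ i, k < i → b (g.coeff i) = 0 := fun i hi => by
            rw [← sign_eq_zero_iff, ← hHc g hg i, ha0 i hi, sign_zero]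
          obtain ⟨-, N, q, hqr⟩ := hrem g k hkpos
          refine sign_eval_eq_of_root hqr hck hckb (by rwa [trunc a ha0]) ?_ ?_
          · rw [trunc b hb0, ← sign_eq_zero_iff, ← hφH g hg, hx, sign_zero]
          · refine hφ _ ?_ x
            refine Finset.mem_union_right _ (Finset.mem_union_right _ (Finset.mem_union_right _ ?_))
            exact Finset.mem_image.2 ⟨(g, k), by simp [hg, hkd]; omega, rfl⟩) hc hfc
        refine ⟨ψ, fun g hg x => hψ g ?_ x⟩
        rw [Finset.insert_union, Finset.coe_insert] at hg
        rcases hg with rfl | hg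
        · exact Set.mem_insert _ _
        · exact Set.mem_insert_of_mem _ (by simp only [hH, Finset.coe_insert]; exact Or.inr hg)
end SignDiagram

section Definability

/-- Polynomial functions. -/
@[fun_prop]
def IsPolyFun {ι : Type*} (f : (ι → ℝ) → ℝ) : Prop :=
  ∃ p : MvPolynomial ι ℝ, ∀ x, MvPolynomial.eval x p = f x

namespace IsPolyFun

variable {ι : Type*} {f g : (ι → ℝ) → ℝ}

@[fun_prop]
theorem coord (i : ι) : IsPolyFun fun x : ι → ℝ => x i := ⟨.X i, by simp⟩

@[fun_prop]
theorem const (c : ℝ) : IsPolyFun fun _ : ι → ℝ => c := ⟨.C c, by simp⟩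

@[fun_prop]
theorem add (hf : IsPolyFun f) (hg : IsPolyFun g) : IsPolyFun fun x => f x + g x := by
  obtain ⟨p, hp⟩ := hf
  obtain ⟨q, hq⟩ := hg
  exact ⟨p + q, by simp [hp, hq]⟩

@[fun_prop]
theorem sub (hf : IsPolyFun f) (hg : IsPolyFun g) : IsPolyFun fun x => f x - g x := by
  obtain ⟨p, hp⟩ := hf
  obtain ⟨q, hq⟩ := hg
  exact ⟨p - q, by simp [hp, hq]⟩

@[fun_prop]
theorem mul (hf : IsPolyFun f) (hg : IsPolyFun g) : IsPolyFun fun x => f x * g x := by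
  obtain ⟨p, hp⟩ := hf
  obtain ⟨q, hq⟩ := hg
  exact ⟨p * q, by simp [hp, hq]⟩

@[fun_prop]
theorem pow (hf : IsPolyFun f) (n : ℕ) : IsPolyFun fun x => f x ^ n := by
  obtain ⟨p, hp⟩ := hf
  exact ⟨p ^ n, by simp [hp]⟩

@[fun_prop]
theorem sum {κ : Type*} (s : Finset κ) {f : κ → (ι → ℝ) → ℝ} (hf : ∀ k, IsPolyFun (f k)) :
    IsPolyFun fun x => ∑ k ∈ s, f k x := by
  choose p hp using hf
  exact ⟨∑ k ∈ s, p k, by simp [hp]⟩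

end IsPolyFun

/-- A predicate on `ℝ^ι` is semialgebraic if its truth value only depends on the signs of finitely
many polynomials. -/
def IsSemialgPred {ι : Type*} (P : (ι → ℝ) → Prop) : Prop :=
  ∃ F : Finset (MvPolynomial ι ℝ), ∀ a b : ι → ℝ,
    (∀ f ∈ F, SignType.sign (f.eval a) = SignType.sign (f.eval b)) → (P a ↔ P b)

namespace IsSemialgPred

variable {ι κ α : Type*} {P Q : (ι → ℝ) → Prop}

theorem not (hP : IsSemialgPred P) : IsSemialgPred fun x => ¬ P x := by
  obtain ⟨F, hF⟩ := hP
  exact ⟨F, fun a b h => not_congr (hF a b h)⟩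

theorem and (hP : IsSemialgPred P) (hQ : IsSemialgPred Q) : IsSemialgPred fun x => P x ∧ Q x := by
  classical
  obtain ⟨F, hF⟩ := hP
  obtain ⟨G, hG⟩ := hQ
  exact ⟨F ∪ G, fun a b h => and_congr (hF a b fun f hf => h f (by simp [hf]))
    (hG a b fun f hf => h f (by simp [hf]))⟩

theorem or (hP : IsSemialgPred P) (hQ : IsSemialgPred Q) : IsSemialgPred fun x => P x ∨ Q x := by
  simpa only [not_and_or, not_not] using (hP.not.and hQ.not).not

theorem imp (hP : IsSemialgPred P) (hQ : IsSemialgPred Q) : IsSemialgPred fun x => P x → Q x := by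
  simpa only [imp_iff_not_or] using hP.not.or hQ

theorem lt {f g : (ι → ℝ) → ℝ} (hf : IsPolyFun f) (hg : IsPolyFun g) :
    IsSemialgPred fun x => f x < g x := by
  obtain ⟨p, hp⟩ := hg.sub hf
  refine ⟨{p}, fun a b h => ?_⟩
  have := h p (by simp)
  simp only [hp] at this
  show f a < g a ↔ f b < g b
  rw [← sub_pos, ← sign_eq_one_iff, this, sign_eq_one_iff, sub_pos]

theorem le {f g : (ι → ℝ) → ℝ} (hf : IsPolyFun f) (hg : IsPolyFun g) :
    IsSemialgPred fun x => f x ≤ g x := by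
  simpa only [not_lt] using (lt hg hf).not

/-- Substitution of polynomial functions. -/
theorem comp (hP : IsSemialgPred P) {g : (α → ℝ) → ι → ℝ}
    (hg : ∀ i, IsPolyFun fun x => g x i) : IsSemialgPred fun x => P (g x) := by
  classical
  choose p hp using hg
  obtain ⟨F, hF⟩ := hP
  refine ⟨F.image (MvPolynomial.bind₁ p), fun a b h => hF _ _ fun f hf => ?_⟩
  have key : ∀ x, MvPolynomial.eval (g x) f = MvPolynomial.eval x (MvPolynomial.bind₁ p f) := by
    intro x
    have : g x = fun i => MvPolynomial.eval x (p i) := funext fun i => (hp i x).symm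
    rw [this]
    exact (MvPolynomial.eval₂Hom_bind₁ (RingHom.id ℝ) x p f).symm
  rw [key, key]
  exact h _ (Finset.mem_image_of_mem _ hf)

/-- Substitution of polynomial functions in a relation. -/
theorem comp₂ {R : (ι → ℝ) → (κ → ℝ) → Prop}
    (hR : IsSemialgPred fun z : ι ⊕ κ → ℝ => R (fun i => z (.inl i)) fun k => z (.inr k))
    {f : (α → ℝ) → ι → ℝ} {g : (α → ℝ) → κ → ℝ} (hf : ∀ i, IsPolyFun fun x => f x i)
    (hg : ∀ k, IsPolyFun fun x => g x k) : IsSemialgPred fun x => R (f x) (g x) :=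
  hR.comp (g := fun x => Sum.elim (f x) (g x)) fun i => by
    rcases i with i | i
    · exact hf i
    · exact hg i

/-- Substitution of polynomial functions in a relation between vectors and numbers. -/
theorem comp₁ {R : (ι → ℝ) → ℝ → Prop}
    (hR : IsSemialgPred fun z : Option ι → ℝ => R (fun i => z (some i)) (z none))
    {f : (α → ℝ) → ι → ℝ} {g : (α → ℝ) → ℝ} (hf : ∀ i, IsPolyFun fun x => f x i)
    (hg : IsPolyFun g) : IsSemialgPred fun x => R (f x) (g x) :=
  hR.comp (g := fun x o => o.elim (g x) (f x)) fun i => by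
    rcases i with _ | i
    · exact hg
    · exact hf i

/-- Tarski–Seidenberg theorem. -/
theorem exists_real {R : (ι → ℝ) → ℝ → Prop}
    (hR : IsSemialgPred fun z : Option ι → ℝ => R (fun i => z (some i)) (z none)) :
    IsSemialgPred fun x => ∃ y, R x y := by
  classical
  obtain ⟨F, hF⟩ := hR
  obtain ⟨P, hP⟩ := exists_finset_sameSignDiagram (F.image (MvPolynomial.optionEquivLeft ℝ ι))
  have main : ∀ a b : ι → ℝ,
      (∀ f ∈ P, SignType.sign (f.eval a) = SignType.sign (f.eval b)) → (∃ y, R a y) → ∃ y, R b y := by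
    rintro a b hab ⟨y, hy⟩
    obtain ⟨φ, hφ⟩ := hP (MvPolynomial.eval a) (MvPolynomial.eval b) hab
    refine ⟨φ y, (hF (fun o => o.elim y a) (fun o => o.elim (φ y) b) fun f hf => ?_).1 hy⟩
    rw [MvPolynomial.optionEquivLeft_elim_eval, MvPolynomial.optionEquivLeft_elim_eval]
    exact hφ _ (Finset.mem_coe.2 (Finset.mem_image_of_mem _ hf)) y
  exact ⟨P, fun a b hab => ⟨main a b hab, main b a fun f hf => (hab f hf).symm⟩⟩

theorem forall_real {R : (ι → ℝ) → ℝ → Prop}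
    (hR : IsSemialgPred fun z : Option ι → ℝ => R (fun i => z (some i)) (z none)) :
    IsSemialgPred fun x => ∀ y, R x y := by
  have : IsSemialgPred fun x => ∃ y, ¬ R x y := exists_real hR.not
  simpa only [not_exists, not_not] using this.not

theorem exists_vec {n : ℕ} {R : (ι → ℝ) → (Fin n → ℝ) → Prop}
    (hR : IsSemialgPred fun z : ι ⊕ Fin n → ℝ => R (fun i => z (.inl i)) fun k => z (.inr k)) :
    IsSemialgPred fun x => ∃ w, R x w := by
  induction n generalizing ι with
  | zero =>
    have h : IsSemialgPred fun x : ι → ℝ => R x Fin.elim0 :=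
      hR.comp₂ (fun i => by fun_prop) fun k => k.elim0
    have hiff : ∀ x, (∃ w, R x w) ↔ R x Fin.elim0 := fun x =>
      ⟨fun ⟨w, hw⟩ => Subsingleton.elim w Fin.elim0 ▸ hw, fun hw => ⟨_, hw⟩⟩
    simpa only [hiff] using h
  | succ n ih =>
    have h : IsSemialgPred fun x => ∃ y, ∃ w, R x (Fin.cons y w) := by
      refine exists_real (ih ?_)
      refine hR.comp₂ (fun i => by fun_prop) (Fin.cases ?_ fun k => ?_)
      · simp only [Fin.cons_zero]; fun_prop
      · simp only [Fin.cons_succ]; fun_prop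
    simpa only [Fin.exists_fin_succ_pi] using h

theorem forall_vec {n : ℕ} {R : (ι → ℝ) → (Fin n → ℝ) → Prop}
    (hR : IsSemialgPred fun z : ι ⊕ Fin n → ℝ => R (fun i => z (.inl i)) fun k => z (.inr k)) :
    IsSemialgPred fun x => ∀ w, R x w := by
  have : IsSemialgPred fun x => ∃ w, ¬ R x w := exists_vec hR.not
  simpa only [not_exists, not_not] using this.not

theorem exists_finset_forall_iff {T : ℝ → Prop} (hT : IsSemialgPred fun z : Unit → ℝ => T (z ())) :
    ∃ Z : Finset ℝ, ∀ x y, (∀ z ∈ Z, z ∉ uIcc x y) → (T x ↔ T y) := by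
  classical
  obtain ⟨F, hF⟩ := hT
  let u : MvPolynomial Unit ℝ →ₐ[ℝ] Polynomial ℝ := MvPolynomial.aeval fun _ => Polynomial.X
  have key : ∀ (f : MvPolynomial Unit ℝ) (x : ℝ),
      MvPolynomial.eval (fun _ => x) f = (u f).eval x := by
    intro f x
    induction f using MvPolynomial.induction_on with
    | C c => simp [u]
    | add p q hp hq => simp [hp, hq]
    | mul_X p o hp => simp [hp, u]
  refine ⟨F.biUnion fun f => (u f).roots.toFinset, fun x y h => ?_⟩
  refine hF (fun _ => x) (fun _ => y) fun f hf => ?_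
  rw [key, key]
  by_cases h0 : u f = 0
  · simp [h0]
  refine Polynomial.sign_eval_eq_of_forall_ne_zero _ fun z hz hz0 => h z ?_ hz
  simp only [Finset.mem_biUnion, Multiset.mem_toFinset]
  exact ⟨f, hf, (Polynomial.mem_roots h0).2 hz0⟩

theorem eventually_or {T : ℝ → Prop} (hT : IsSemialgPred fun z : Unit → ℝ => T (z ()))
    {l : Filter ℝ} (hl : ∀ Z : Finset ℝ, ∃ s ∈ l, OrdConnected s ∧ Disjoint s (Z : Set ℝ)) :
    (∀ᶠ x in l, T x) ∨ ∀ᶠ x in l, ¬ T x := by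
  obtain ⟨Z, hZ⟩ := hT.exists_finset_forall_iff
  obtain ⟨s, hs, hsc, hsZ⟩ := hl Z
  have hiff : ∀ x ∈ s, ∀ y ∈ s, (T x ↔ T y) := fun x hx y hy => hZ x y fun z hz hzx =>
    hsZ.le_bot ⟨hsc.uIcc_subset hx hy hzx, hz⟩
  by_cases h : ∃ x ∈ s, T x
  · obtain ⟨x, hx, hTx⟩ := h
    left
    filter_upwards [hs] with y hy using (hiff x hx y hy).1 hTx
  · right
    filter_upwards [hs] with y hy hTy using h ⟨y, hy, hTy⟩

theorem eventually_atTop_or {T : ℝ → Prop} (hT : IsSemialgPred fun z : Unit → ℝ => T (z ())) :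
    (∀ᶠ x in atTop, T x) ∨ ∀ᶠ x in atTop, ¬ T x := by
  refine hT.eventually_or fun Z => ?_
  obtain ⟨M, hM⟩ := Z.exists_le
  exact ⟨Ioi M, Ioi_mem_atTop M, ordConnected_Ioi, Set.disjoint_left.2 fun x hx hxZ =>
    (hM x hxZ).not_gt hx⟩

theorem eventually_nhdsGT_or {T : ℝ → Prop} (hT : IsSemialgPred fun z : Unit → ℝ => T (z ()))
    (x : ℝ) : (∀ᶠ y in 𝓝[>] x, T y) ∨ ∀ᶠ y in 𝓝[>] x, ¬ T y := by
  refine hT.eventually_or fun Z => ?_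
  obtain ⟨u, hu, h⟩ := Z.exists_gt_forall_ge_of_gt x
  exact ⟨Ioo x u, Ioo_mem_nhdsGT hu, ordConnected_Ioo, Set.disjoint_left.2 fun y hy hyZ =>
    (h y hyZ hy.1).not_gt hy.2⟩

theorem eventually_nhdsLT_or {T : ℝ → Prop} (hT : IsSemialgPred fun z : Unit → ℝ => T (z ()))
    (x : ℝ) : (∀ᶠ y in 𝓝[<] x, T y) ∨ ∀ᶠ y in 𝓝[<] x, ¬ T y := by
  refine hT.eventually_or fun Z => ?_
  obtain ⟨u, hu, h⟩ := Z.exists_lt_forall_le_of_lt x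
  exact ⟨Ioo u x, Ioo_mem_nhdsLT hu, ordConnected_Ioo, Set.disjoint_left.2 fun y hy hyZ =>
    (h y hyZ hy.2).not_gt hy.1⟩

end IsSemialgPred
end Definability

section DefinableChoice

variable {ι : Type*}

/-- A selector of a real number satisfying `T`: the least one if it exists; otherwise, if `T` holds
on an interval starting at its infimum `m`, a point of this interval. -/
def LeastSelector (T : ℝ → Prop) (y : ℝ) : Prop :=
  (T y ∧ ∀ y', T y' → y ≤ y') ∨
    ∃ m, (∀ y', T y' → m < y') ∧
      ((m < y ∧ y ≤ m + 1) ∧ ∀ y', m < y' → y' < y + (y - m) → T y') ∧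
      ∀ x, ((m < x ∧ x ≤ m + 1) ∧ ∀ y', m < y' → y' < x + (x - m) → T y') → x ≤ y

namespace LeastSelector

variable {T : ℝ → Prop} {y y₁ y₂ : ℝ}

theorem of_selected (h : LeastSelector T y) : T y := by
  rcases h with h | ⟨m, -, ⟨h, hT⟩, -⟩
  · exact h.1
  · exact hT y h.1 (by linarith [h.1])

theorem isGLB_of_forall_lt {m : ℝ} (hm : ∀ y', T y' → m < y') (hy : m < y)
    (h : ∀ y', m < y' → y' < y + (y - m) → T y') : IsGLB {y | T y} m := by
  refine ⟨fun z hz => (hm z hz).le, fun b hb => le_of_forall_gt_imp_ge_of_dense fun a ha => ?_⟩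
  have h1 : m < min a y := lt_min ha hy
  have h2 := min_le_right a y
  exact (hb (h _ h1 (by linarith))).trans (min_le_left a y)

theorem unique (h₁ : LeastSelector T y₁) (h₂ : LeastSelector T y₂) : y₁ = y₂ := by
  have key : ∀ {m y y'}, T y → (∀ z, T z → y ≤ z) → (∀ z, T z → m < z) → m < y' →
      (∀ z, m < z → z < y' + (y' - m) → T z) → False := fun {m y y'} h0 h1 h2 h3 h4 =>
    (h2 y h0).ne ((isGLB_of_forall_lt h2 h3 h4).unique (IsLeast.isGLB ⟨h0, h1⟩))
  rcases h₁ with h₁ | ⟨m₁, h₁, h₁', h₁''⟩ <;> rcases h₂ with h₂ | ⟨m₂, h₂, h₂', h₂''⟩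
  · exact le_antisymm (h₁.2 _ h₂.1) (h₂.2 _ h₁.1)
  · exact (key h₁.1 h₁.2 h₂ h₂'.1.1 h₂'.2).elim
  · exact (key h₂.1 h₂.2 h₁ h₁'.1.1 h₁'.2).elim
  · obtain rfl : m₁ = m₂ := (isGLB_of_forall_lt h₁ h₁'.1.1 h₁'.2).unique
      (isGLB_of_forall_lt h₂ h₂'.1.1 h₂'.2)
    exact le_antisymm (h₂'' _ h₁') (h₁'' _ h₂')

theorem exists_of_bddBelow (hT : IsSemialgPred fun z : Unit → ℝ => T (z ())) (hne : ∃ y, T y)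
    (hb : BddBelow {y | T y}) : ∃ y, LeastSelector T y := by
  have hglb : IsGLB {y | T y} (sInf {y | T y}) := isGLB_csInf hne hb
  generalize sInf {y | T y} = m at hglb
  by_cases hm : T m
  · exact ⟨m, .inl ⟨hm, fun y hy => hglb.1 hy⟩⟩
  have hlt : ∀ y, T y → m < y := fun y hy =>
    lt_of_le_of_ne (hglb.1 hy) fun h => hm (h ▸ hy)
  have hev : ∀ᶠ y in 𝓝[>] m, T y := by
    refine (hT.eventually_nhdsGT_or m).resolve_right fun h => ?_
    obtain ⟨u, hu, hu'⟩ := (mem_nhdsGT_iff_exists_Ioo_subset).1 h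
    obtain ⟨z, hz, -, hzu⟩ := hglb.exists_between hu
    exact hu' ⟨hlt z hz, hzu⟩ hz
  obtain ⟨u, hu, hTu⟩ := (mem_nhdsGT_iff_exists_Ioo_subset).1 hev
  rw [mem_Ioi] at hu
  set A : Set ℝ := {x | (m < x ∧ x ≤ m + 1) ∧ ∀ y', m < y' → y' < x + (x - m) → T y'}
  have hA : A.Nonempty := by
    refine ⟨min (m + 1) ((m + u) / 2), ⟨lt_min (by linarith) (by linarith), min_le_left _ _⟩,
      fun y' h1 h2 => hTu ⟨h1, ?_⟩⟩
    linarith [min_le_right (m + 1) ((m + u) / 2)]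
  have hAb : BddAbove A := ⟨m + 1, fun x hx => hx.1.2⟩
  have hlub := isLUB_csSup hA hAb
  obtain ⟨x, hx⟩ := hA
  refine ⟨sSup A, .inr ⟨m, hlt, ⟨⟨hx.1.1.trans_le (hlub.1 hx), hlub.2 fun x hx => hx.1.2⟩,
    fun y' h1 h2 => ?_⟩, fun x hx => hlub.1 hx⟩⟩
  obtain ⟨x, hx, hlt, -⟩ := hlub.exists_between (show (y' + m) / 2 < sSup A by linarith)
  exact hx.2 y' h1 (by linarith)

theorem isSemialgPred {R : (ι → ℝ) → ℝ → Prop}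
    (hR : IsSemialgPred fun z : Option ι → ℝ => R (fun i => z (some i)) (z none)) :
    IsSemialgPred fun z : Option ι → ℝ => LeastSelector (R fun i => z (some i)) (z none) := by
  unfold LeastSelector
  have h : ∀ {α : Type _} (s : ι → α) (y m : α), IsSemialgPred fun z : α → ℝ =>
      (z m < z y ∧ z y ≤ z m + 1) ∧
        ∀ y', z m < y' → y' < z y + (z y - z m) → R (fun i => z (s i)) y' := fun {α} s y m =>
    .and (.and (.lt (by fun_prop) (by fun_prop)) (.le (by fun_prop) (by fun_prop)))
      (.forall_real (.imp (.lt (by fun_prop) (by fun_prop)) (.imp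
        (.lt (by fun_prop) (by fun_prop)) (.comp₁ (R := R) hR (by fun_prop) (by fun_prop)))))
  refine .or (.and hR (.forall_real (.imp (.comp₁ (R := R) hR (by fun_prop) (by fun_prop))
    (.le (by fun_prop) (by fun_prop))))) (.exists_real (.and (.forall_real (.imp
      (.comp₁ (R := R) hR (by fun_prop) (by fun_prop)) (.lt (by fun_prop) (by fun_prop))))
      (.and (h (fun i => some (some i)) (some none) none) (.forall_real (.imp
        (h (fun i => some (some (some i))) none (some none)) (.le (by fun_prop) (by fun_prop)))))))

end LeastSelector

theorem exists_semialg_choice_real {R : (ι → ℝ) → ℝ → Prop}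
    (hR : IsSemialgPred fun z : Option ι → ℝ => R (fun i => z (some i)) (z none))
    (hne : ∀ x, ∃ y, R x y) (hb : ∀ x, BddBelow {y | R x y}) :
    ∃ c : (ι → ℝ) → ℝ, (∀ x, R x (c x)) ∧
      IsSemialgPred fun z : Option ι → ℝ => z none = c fun i => z (some i) := by
  choose c hc using fun x => LeastSelector.exists_of_bddBelow
    (.comp₁ (R := R) hR (f := fun _ => x) (by fun_prop) (by fun_prop)) (hne x) (hb x)
  refine ⟨c, fun x => (hc x).of_selected, ?_⟩
  have h : ∀ x y, y = c x ↔ LeastSelector (R x) y := fun x y =>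
    ⟨fun h => h ▸ hc x, fun h => h.unique (hc x)⟩
  simpa only [h] using LeastSelector.isSemialgPred hR

theorem exists_semialg_choice {n : ℕ} {R : (ι → ℝ) → (Fin n → ℝ) → Prop}
    (hR : IsSemialgPred fun z : ι ⊕ Fin n → ℝ => R (fun i => z (.inl i)) fun k => z (.inr k))
    (hne : ∀ x, ∃ w, R x w) (hb : ∀ x, ∃ B : ℝ, ∀ w, R x w → ∀ j, B ≤ w j) :
    ∃ c : (ι → ℝ) → Fin n → ℝ, (∀ x, R x (c x)) ∧
      ∀ j, IsSemialgPred fun z : Option ι → ℝ => z none = c (fun i => z (some i)) j := by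
  induction n with
  | zero =>
    choose c hc using hne
    exact ⟨c, hc, fun j => j.elim0⟩
  | succ n ih =>
    choose B hB using hb
    have hcons : ∀ {α : Type _} (s : ι → α) (y : α) (w : Fin n → α),
        IsSemialgPred fun z : α → ℝ =>
          R (fun i => z (s i)) (Fin.cons (z y) fun k => z (w k)) := fun {α} s y w => by
      refine .comp₂ (R := R) hR (by fun_prop) (Fin.cases ?_ fun k => ?_)
      · simp only [Fin.cons_zero]; fun_prop
      · simp only [Fin.cons_succ]; fun_prop
    obtain ⟨c₀, hc₀, hc₀'⟩ := exists_semialg_choice_real (R := fun x y => ∃ w, R x (Fin.cons y w))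
      (.exists_vec (hcons (fun i => Sum.inl (some i)) (Sum.inl none) Sum.inr))
      (fun x => by
        obtain ⟨w, hw⟩ := hne x
        exact ⟨w 0, Fin.tail w, by rwa [Fin.cons_self_tail]⟩)
      fun x => ⟨B x, fun y ⟨w, hw⟩ => by simpa using hB x _ hw 0⟩
    obtain ⟨c₁, hc₁, hc₁'⟩ := ih (R := fun x w => R x (Fin.cons (c₀ x) w)) (by
        have h : IsSemialgPred fun z : ι ⊕ Fin n → ℝ => ∃ y, y = c₀ (fun i => z (.inl i)) ∧
            R (fun i => z (.inl i)) (Fin.cons y fun k => z (.inr k)) :=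
          .exists_real (.and (.comp₁ (R := fun x y => y = c₀ x) hc₀' (by fun_prop) (by fun_prop))
            (hcons (fun i => some (Sum.inl i)) none fun k => some (Sum.inr k)))
        simpa only [exists_eq_left] using h)
      hc₀ fun x => ⟨B x, fun w hw j => by simpa using hB x _ hw j.succ⟩
    exact ⟨fun x => Fin.cons (c₀ x) (c₁ x), hc₁, Fin.cases (by simpa using hc₀')
      fun j => by simpa using hc₁' j⟩

end DefinableChoice

section SemialgFunctions

/-- A function of a real variable with semialgebraic graph. -/
def IsSemialgFun (f : ℝ → ℝ) : Prop :=
  IsSemialgPred fun z : Option Unit → ℝ => z none = f (z (some ()))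

namespace IsSemialgFun

variable {f : ℝ → ℝ}

theorem comp {α : Type*} (hf : IsSemialgFun f) {y t : (α → ℝ) → ℝ} (hy : IsPolyFun y)
    (ht : IsPolyFun t) : IsSemialgPred fun z => y z = f (t z) :=
  .comp₁ (R := fun (x : Unit → ℝ) y => y = f (x ())) hf (f := fun z _ => t z) (fun _ => ht) hy

theorem neg (hf : IsSemialgFun f) : IsSemialgFun fun t => -f t := by
  have h : IsSemialgPred fun z : Option Unit → ℝ => (-1) * z none = f (z (some ())) :=
    hf.comp (by fun_prop) (by fun_prop)
  simpa only [IsSemialgFun, neg_one_mul, neg_eq_iff_eq_neg] using h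

theorem lt_const (hf : IsSemialgFun f) (q : ℝ) :
    IsSemialgPred fun z : Unit → ℝ => f (z ()) < q := by
  have h : IsSemialgPred fun z : Unit → ℝ => ∃ y, y = f (z ()) ∧ y < q :=
    .exists_real (.and (hf.comp (by fun_prop) (by fun_prop)) (.lt (by fun_prop) (by fun_prop)))
  simpa only [exists_eq_left] using h

theorem countable_not_upperSemicontinuousAt (hf : IsSemialgFun f) :
    {t | ¬ UpperSemicontinuousAt f t}.Countable := by
  have h : {t | ¬ UpperSemicontinuousAt f t} ⊆ ⋃ q : ℚ,
      ({t ∈ {t | f t < q} | 𝓝[{t | f t < q} ∩ Ioi t] t = ⊥} ∪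
        {t ∈ {t | f t < q} | 𝓝[{t | f t < q} ∩ Iio t] t = ⊥}) := by
    intro t ht
    simp only [UpperSemicontinuousAt, upperSemicontinuousAt_iff, mem_ofPred_eq, not_forall] at ht
    obtain ⟨y, hy, ht⟩ := ht
    obtain ⟨q, hq, hqy⟩ := exists_rat_btwn hy
    refine mem_iUnion.2 ⟨q, ?_⟩
    have hT := hf.lt_const q
    have ht' : ¬ ∀ᶠ s in 𝓝 t, f s < q := fun h => ht (h.mono fun s hs => hs.trans hqy)
    rcases hT.eventually_nhdsGT_or (T := fun s => f s < q) t with h1 | h1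
    · rcases hT.eventually_nhdsLT_or (T := fun s => f s < q) t with h2 | h2
      · refine (ht' ?_).elim
        rw [← nhdsNE_sup_pure, punctured_nhds_eq_nhdsWithin_sup_nhdsWithin]
        exact eventually_sup.2 ⟨eventually_sup.2 ⟨h2, h1⟩, hq⟩
      · refine .inr ⟨hq, ?_⟩
        rw [inter_comm, nhdsWithin_inter', inf_principal_eq_bot]
        exact h2
    · refine .inl ⟨hq, ?_⟩
      rw [inter_comm, nhdsWithin_inter', inf_principal_eq_bot]
      exact h1
  refine Countable.mono h (countable_iUnion fun q => .union ?_ ?_)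
  · exact countable_setOfPred_isolated_right_within
  · exact countable_setOfPred_isolated_left_within

theorem eventually_continuous (hf : IsSemialgFun f) : ∃ M, ContinuousOn f (Ioi M) := by
  have hdisc : IsSemialgPred fun z : Unit → ℝ => ∃ e, 0 < e ∧ ∀ d, 0 < d → ∃ s y y', y = f s ∧
      y' = f (z ()) ∧ s < z () + d ∧ z () < s + d ∧ (y + e ≤ y' ∨ y' + e ≤ y) :=
    .exists_real (.and (.lt (by fun_prop) (by fun_prop)) (.forall_real (.imp
      (.lt (by fun_prop) (by fun_prop)) (.exists_real (.exists_real (.exists_real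
        (.and (hf.comp (by fun_prop) (by fun_prop)) (.and (hf.comp (by fun_prop) (by fun_prop))
          (.and (.lt (by fun_prop) (by fun_prop)) (.and (.lt (by fun_prop) (by fun_prop))
            (.or (.le (by fun_prop) (by fun_prop)) (.le (by fun_prop) (by fun_prop)))))))))))))
  have hiff : ∀ t : ℝ, (∃ e, 0 < e ∧ ∀ d, 0 < d → ∃ s y y', y = f s ∧
      y' = f t ∧ s < t + d ∧ t < s + d ∧ (y + e ≤ y' ∨ y' + e ≤ y)) ↔ ¬ ContinuousAt f t := by
    intro t
    rw [Metric.continuousAt_iff]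
    push Not
    refine exists_congr fun e => and_congr_right fun he => forall₂_congr fun d hd =>
      exists_congr fun s => ?_
    simp only [Real.dist_eq, abs_lt, le_abs]
    constructor
    · rintro ⟨y, y', rfl, rfl, h1, h2, h3 | h3⟩
      · exact ⟨⟨by linarith, by linarith⟩, .inr (by linarith)⟩
      · exact ⟨⟨by linarith, by linarith⟩, .inl (by linarith)⟩
    · rintro ⟨⟨h1, h2⟩, h3 | h3⟩
      · exact ⟨_, _, rfl, rfl, by linarith, by linarith, .inr (by linarith)⟩
      · exact ⟨_, _, rfl, rfl, by linarith, by linarith, .inl (by linarith)⟩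
  simp only [hiff] at hdisc
  have hc : {t | ¬ ContinuousAt f t}.Countable := by
    refine (hf.countable_not_upperSemicontinuousAt.union
      hf.neg.countable_not_upperSemicontinuousAt).mono fun t ht => ?_
    by_contra! h
    simp only [mem_union, mem_ofPred_eq, not_or, not_not] at h
    refine ht (continuousAt_iff_lower_upperSemicontinuousAt.2 ⟨fun y hy => ?_, h.1⟩)
    exact (h.2 (-y) (by simpa using hy)).mono fun s hs => by simpa using hs
  rcases hdisc.eventually_atTop_or (T := fun t => ¬ ContinuousAt f t) with h | h
  · obtain ⟨M, hM⟩ := eventually_atTop.1 h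
    have := (hc.mono fun t (ht : t ∈ Ioi M) => hM t (le_of_lt ht)).le_aleph0
    rw [Cardinal.mk_Ioi_real] at this
    exact (Cardinal.aleph0_lt_continuum.not_ge this).elim
  · obtain ⟨M, hM⟩ := eventually_atTop.1 h
    exact ⟨M, fun t ht => (not_not.1 (hM t (le_of_lt ht))).continuousWithinAt⟩

end IsSemialgFun
end SemialgFunctions

section SemialgebraicSets

theorem IsSemialgPred.forall_fintype {ι κ : Type*} [Fintype κ] {P : κ → (ι → ℝ) → Prop}
    (h : ∀ k, IsSemialgPred (P k)) : IsSemialgPred fun x => ∀ k, P k x := by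
  classical
  choose F hF using h
  exact ⟨Finset.univ.biUnion F, fun a b hab => forall_congr' fun k => hF k a b fun f hf =>
    hab f (Finset.mem_biUnion.2 ⟨k, Finset.mem_univ k, hf⟩)⟩

variable {n m : ℕ}

theorem isSemialgebraic_iff {X : Set (EuclideanSpace ℝ (Fin n))} :
    IsSemialgebraic X ↔ IsSemialgPred fun z : Fin n → ℝ => WithLp.toLp 2 z ∈ X := by
  classical
  constructor
  · rintro ⟨m, P, k, Q, rfl⟩
    refine ⟨Finset.univ.image P ∪ Finset.univ.biUnion fun i => Finset.univ.image (Q i),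
      fun a b hab => ?_⟩
    simp only [mem_iUnion, mem_ofPred_eq]
    refine exists_congr fun i => and_congr ?_ (forall_congr' fun l => ?_)
    · have := hab (P i) (by simp)
      rw [← sign_eq_zero_iff, this, sign_eq_zero_iff]
    · have := hab (Q i l) (by simpa using .inr ⟨i, l, rfl⟩)
      rw [← sign_eq_one_iff, this, sign_eq_one_iff]
  · rintro ⟨F, hF⟩
    let T : Type := {σ : F → SignType // ∃ a : Fin n → ℝ, WithLp.toLp 2 a ∈ X ∧
      ∀ f : F, SignType.sign (f.1.eval a) = σ f}
    let e := Fintype.equivFin T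
    let e' := Fintype.equivFin F
    refine ⟨Fintype.card T, fun i => ∑ f : F, if (e.symm i).1 f = 0 then f.1 ^ 2 else 0,
      fun _ => Fintype.card F, fun i l => if (e.symm i).1 (e'.symm l) = 0 then 1 else
        MvPolynomial.C (((e.symm i).1 (e'.symm l) : ℤ) : ℝ) * (e'.symm l).1, ?_⟩
    have key : ∀ (σ : F → SignType) (x : Fin n → ℝ),
        (MvPolynomial.eval x (∑ f : F, if σ f = 0 then f.1 ^ 2 else 0) = 0 ∧
          ∀ l, 0 < MvPolynomial.eval x (if σ (e'.symm l) = 0 then 1 else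
            MvPolynomial.C ((σ (e'.symm l) : ℤ) : ℝ) * (e'.symm l).1)) ↔
        ∀ f : F, SignType.sign (f.1.eval x) = σ f := by
      intro σ x
      rw [map_sum, Finset.sum_eq_zero_iff_of_nonneg (by
        intro f _
        split_ifs
        · rw [map_pow]; positivity
        · simp), e'.symm.forall_congr_right (q := fun f => 0 < MvPolynomial.eval x
          (if σ f = 0 then 1 else MvPolynomial.C ((σ f : ℤ) : ℝ) * f.1))]
      simp only [Finset.mem_univ, true_imp_iff, ← forall_and]
      refine forall_congr' fun f => ?_
      rcases h : σ f with _ | _ | _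
      · simp [sign_eq_zero_iff]
      · simp [sign_eq_neg_one_iff]
      · simp [sign_eq_one_iff]
    ext x
    simp only [mem_iUnion, mem_ofPred_eq, key]
    constructor
    · intro hx
      exact ⟨e ⟨fun f => SignType.sign (f.1.eval fun j => x j), fun j => x j, hx, fun f => rfl⟩,
        fun f => by simp⟩
    · rintro ⟨i, hi⟩
      obtain ⟨a, ha, haσ⟩ := (e.symm i).2
      exact (hF a (fun j => x j) fun f hf => (haσ ⟨f, hf⟩).trans (hi ⟨f, hf⟩).symm).1 ha

theorem IsSemialgebraicMapOn.isSemialgPred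
    {h : EuclideanSpace ℝ (Fin n) → EuclideanSpace ℝ (Fin m)} {X : Set (EuclideanSpace ℝ (Fin n))}
    (hh : IsSemialgebraicMapOn h X) : IsSemialgPred fun z : Fin n ⊕ Fin m → ℝ =>
      WithLp.toLp 2 (fun i => z (.inl i)) ∈ X ∧
        ∀ j, z (.inr j) = h (WithLp.toLp 2 fun i => z (.inl i)) j := by
  have := (isSemialgebraic_iff.1 hh).comp (α := Fin n ⊕ Fin m)
    (g := fun z => Fin.append (fun i => z (.inl i)) fun j => z (.inr j))
    (Fin.addCases (fun i => by simp only [Fin.append_left]; fun_prop)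
      fun j => by simp only [Fin.append_right]; fun_prop)
  convert this using 2 with z
  simp only [mem_ofPred_eq, Fin.append_left, Fin.append_right]
  constructor
  · rintro ⟨h1, h2⟩
    exact ⟨_, h1, fun _ => rfl, h2⟩
  · rintro ⟨x, hx, h1, h2⟩
    obtain rfl : x = WithLp.toLp 2 fun i => z (.inl i) := by ext i; exact (h1 i).symm
    exact ⟨hx, h2⟩

theorem IsSemialgebraicArc.isSemialgPred {γ : ℝ → EuclideanSpace ℝ (Fin n)} {ε : ℝ}
    (hγ : IsSemialgebraicArc γ ε) : IsSemialgPred fun z : Unit ⊕ Fin n → ℝ =>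
      ε < z (.inl ()) ∧ ∀ j, z (.inr j) = γ (z (.inl ())) j := by
  have := (isSemialgebraic_iff.1 hγ.2).comp (α := Unit ⊕ Fin n)
    (g := fun z => Fin.append (fun _ : Fin 1 => z (.inl ())) fun j => z (.inr j))
    (Fin.addCases (fun i => by simp only [Fin.append_left]; fun_prop)
      fun j => by simp only [Fin.append_right]; fun_prop)
  convert this using 2 with z
  simp [Fin.append_left, Fin.append_right]

theorem isSemialgebraicArc_of_isSemialgFun {f : ℝ → Fin n → ℝ}
    (hf : ∀ j, IsSemialgFun fun t => f t j) :
    ∃ ε, IsSemialgebraicArc (fun t => WithLp.toLp 2 (f t)) ε := by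
  choose M hM using fun j => (hf j).eventually_continuous
  obtain ⟨ε, hε⟩ := (finite_range M).bddAbove
  refine ⟨ε, (PiLp.continuous_toLp 2 _).comp_continuousOn (continuousOn_pi.2 fun j =>
    (hM j).mono (Ioi_subset_Ioi (hε ⟨j, rfl⟩))), isSemialgebraic_iff.2 ?_⟩
  have h : IsSemialgPred fun z : Fin (1 + n) → ℝ => ε < z (Fin.castAdd n 0) ∧
      ∀ j, z (Fin.natAdd 1 j) = f (z (Fin.castAdd n 0)) j :=
    .and (.lt (by fun_prop) (by fun_prop)) (.forall_fintype fun j =>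
      (hf j).comp (by fun_prop) (by fun_prop))
  convert h using 2 with z
  simp

end SemialgebraicSets

section TangentCones

variable {E : Type*} [NormedAddCommGroup E] [NormedSpace ℝ E] {X : Set E} {v : E}

theorem exists_seq_of_mem_tangConeInf (hv : v ∈ tangConeInf X) :
    ∃ (x : ℕ → E) (t : ℕ → ℝ), (∀ i, x i ∈ X) ∧ (∀ i, 0 < t i) ∧ Tendsto t atTop atTop ∧
      Tendsto (fun i => (t i)⁻¹ • x i) atTop (𝓝 v) := by
  obtain ⟨x, t, hx, ht, hxinf, hxv⟩ := hv
  refine ⟨x, t, hx, ht, ?_, hxv⟩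
  have hC : 0 < ‖v‖ + 1 := by positivity
  refine tendsto_atTop_mono' _ ?_ (hxinf.atTop_div_const hC)
  filter_upwards [hxv.norm.eventually_lt_const (lt_add_one ‖v‖)] with i hi
  rw [norm_smul, norm_inv, Real.norm_of_nonneg (ht i).le, inv_mul_lt_iff₀ (ht i)] at hi
  rw [div_le_iff₀ hC]
  exact hi.le

theorem mem_tangConeInf_of_seq (hX : ¬ Bornology.IsBounded X) {x : ℕ → E} {t : ℕ → ℝ}
    (hx : ∀ i, x i ∈ X) (ht : ∀ i, 0 < t i) (htinf : Tendsto t atTop atTop)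
    (hxv : Tendsto (fun i => (t i)⁻¹ • x i) atTop (𝓝 v)) : v ∈ tangConeInf X := by
  rcases eq_or_ne v 0 with rfl | hv
  · have : ∀ i : ℕ, ∃ y ∈ X, (i : ℝ) < ‖y‖ := by
      intro i
      by_contra! h
      exact hX (isBounded_iff_forall_norm_le.2 ⟨i, h⟩)
    choose y hy hlt using this
    have hpos : ∀ i, 0 < ‖y i‖ := fun i => (Nat.cast_nonneg i).trans_lt (hlt i)
    have hinf : Tendsto (fun i => ‖y i‖) atTop atTop :=
      tendsto_atTop_mono (fun i => (hlt i).le) tendsto_natCast_atTop_atTop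
    refine ⟨y, fun i => ‖y i‖ ^ 2, hy, fun i => by have := hpos i; positivity, hinf, ?_⟩
    rw [tendsto_zero_iff_norm_tendsto_zero]
    refine (tendsto_inv_atTop_zero.comp hinf).congr fun i => ?_
    have := (hpos i).ne'
    simp only [Function.comp_apply, norm_smul, norm_inv, norm_pow, norm_norm]
    field_simp
  · refine ⟨x, t, hx, ht, ?_, hxv⟩
    refine (htinf.atTop_mul_pos (norm_pos_iff.2 hv) hxv.norm).congr fun i => ?_
    rw [norm_smul, norm_inv, Real.norm_of_nonneg (ht i).le, mul_inv_cancel_left₀ (ht i).ne']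

theorem mem_tangConeInf_of_arc (hX : ¬ Bornology.IsBounded X) {γ : ℝ → E}
    (hγ : ∀ᶠ t in atTop, γ t ∈ X) (hγv : Tendsto (fun t => t⁻¹ • γ t) atTop (𝓝 v)) :
    v ∈ tangConeInf X := by
  obtain ⟨M, hM⟩ := eventually_atTop.1 (hγ.and (eventually_gt_atTop 0))
  have h : Tendsto (fun i : ℕ => M + i) atTop atTop :=
    tendsto_atTop_add_const_left _ _ tendsto_natCast_atTop_atTop
  exact mem_tangConeInf_of_seq hX (x := fun i => γ (M + i)) (t := fun i => M + i)
    (fun i => (hM _ (by simp)).1) (fun i => (hM _ (by simp)).2) h (hγv.comp h)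

theorem tendsto_inv_smul_sub_smul_iff {γ : ℝ → E} :
    Tendsto (fun t : ℝ => t⁻¹ • (γ t - t • v)) atTop (𝓝 0) ↔
      Tendsto (fun t : ℝ => t⁻¹ • γ t) atTop (𝓝 v) := by
  rw [← tendsto_sub_nhds_zero_iff (u := fun t => t⁻¹ • γ t)]
  refine tendsto_congr' ?_
  filter_upwards [eventually_ne_atTop 0] with t ht
  rw [smul_sub, inv_smul_smul₀ ht]

end TangentCones

section Arcs

variable {n m : ℕ} {X : Set (EuclideanSpace ℝ (Fin n))} {v : EuclideanSpace ℝ (Fin n)}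

/-- Every tangent vector at infinity of a semialgebraic set is realized by a semialgebraic arc. -/
theorem IsSemialgebraic.exists_arc (hX : IsSemialgebraic X) (hv : v ∈ tangConeInf X) :
    ∃ ε γ, IsSemialgebraicArc γ ε ∧ (∀ t, γ t ∈ X) ∧
      Tendsto (fun t : ℝ => t⁻¹ • γ t) atTop (𝓝 v) := by
  obtain ⟨x, t, hx, ht, htinf, hxv⟩ := exists_seq_of_mem_tangConeInf hv
  rw [isSemialgebraic_iff] at hX
  set D : ℝ → (Fin n → ℝ) → ℝ := fun t w => ∑ j, (w j - t * v j) ^ 2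
  have hD : ∀ t w, D t w = ‖WithLp.toLp 2 w - t • v‖ ^ 2 := by
    intro t w
    simp [D, EuclideanSpace.norm_sq_eq]
  have hD0 : ∀ t w, 0 ≤ D t w := fun t w => Finset.sum_nonneg fun j _ => sq_nonneg _
  have hDt : ∀ {t}, 0 < t → ∀ w, ‖t⁻¹ • WithLp.toLp 2 w - v‖ ^ 2 = D t w / t ^ 2 := by
    intro t ht w
    rw [hD, show t⁻¹ • WithLp.toLp 2 w - v = t⁻¹ • (WithLp.toLp 2 w - t • v) by
      rw [smul_sub, inv_smul_smul₀ ht.ne'], norm_smul, mul_pow, norm_inv,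
      Real.norm_of_nonneg ht.le, inv_pow, inv_mul_eq_div]
  obtain ⟨c, hc, hc'⟩ := exists_semialg_choice (ι := Unit)
    (R := fun s w => WithLp.toLp 2 w ∈ X ∧
      ∀ w', WithLp.toLp 2 w' ∈ X → D (s ()) w ≤ D (s ()) w' + 1)
    (.and (hX.comp (by fun_prop)) (.forall_vec (.imp (hX.comp (by fun_prop))
      (.le (by simp only [D]; fun_prop) (by simp only [D]; fun_prop)))))
    (fun s => by
      have hne : ((D (s ())) '' {w | WithLp.toLp 2 w ∈ X}).Nonempty :=
        ⟨_, WithLp.ofLp (x 0), hx 0, rfl⟩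
      have hbdd : BddBelow ((D (s ())) '' {w | WithLp.toLp 2 w ∈ X}) :=
        ⟨0, by rintro _ ⟨w, -, rfl⟩; exact hD0 _ _⟩
      obtain ⟨_, ⟨w, hw, rfl⟩, hlt⟩ := Real.lt_sInf_add_pos hne one_pos
      refine ⟨w, hw, fun w' hw' => hlt.le.trans ?_⟩
      gcongr
      exact csInf_le hbdd ⟨w', hw', rfl⟩)
    (fun s => by
      set B := D (s ()) (WithLp.ofLp (x 0)) + 1
      obtain ⟨b, hb⟩ := (finite_range fun j => s () * v j).bddBelow
      refine ⟨b - (B + 1), fun w hw j => ?_⟩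
      have h1 := hw.2 _ (hx 0)
      have h2 : (w j - s () * v j) ^ 2 ≤ D (s ()) w :=
        Finset.single_le_sum (f := fun j => (w j - s () * v j) ^ 2)
          (fun j _ => sq_nonneg _) (Finset.mem_univ j)
      have h3 := hb ⟨j, rfl⟩
      simp only at h3
      nlinarith [sq_nonneg (w j - s () * v j + 1)])
  obtain ⟨ε, hε⟩ := isSemialgebraicArc_of_isSemialgFun (f := fun t => c fun _ => t) hc'
  refine ⟨ε, _, hε, fun t => (hc _).1, ?_⟩
  rw [Metric.tendsto_nhds]
  intro η hη
  have hT : IsSemialgPred fun s : Unit → ℝ =>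
      ∃ w, WithLp.toLp 2 w ∈ X ∧ D (s ()) w < η ^ 2 / 2 * s () ^ 2 :=
    .exists_vec (.and (hX.comp (by fun_prop)) (.lt (by simp only [D]; fun_prop) (by fun_prop)))
  have hev : ∀ᶠ s in atTop, ∃ w, WithLp.toLp 2 w ∈ X ∧ D s w < η ^ 2 / 2 * s ^ 2 := by
    refine (hT.eventually_atTop_or (T := fun s => ∃ w, WithLp.toLp 2 w ∈ X ∧
      D s w < η ^ 2 / 2 * s ^ 2)).resolve_right fun h => ?_
    have h0 : Tendsto (fun i => ‖(t i)⁻¹ • x i - v‖ ^ 2) atTop (𝓝 0) := by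
      simpa using (tendsto_sub_nhds_zero_iff.2 hxv).norm.pow 2
    obtain ⟨i, hi, hi'⟩ := ((htinf.eventually h).and
      (h0.eventually_lt_const (show 0 < η ^ 2 / 2 by positivity))).exists
    refine hi ⟨WithLp.ofLp (x i), hx i, ?_⟩
    have := hDt (ht i) (WithLp.ofLp (x i))
    rw [WithLp.toLp_ofLp] at this
    have hti := ht i
    rwa [this, div_lt_iff₀ (by positivity)] at hi'
  filter_upwards [hev, eventually_gt_atTop 0,
    (tendsto_pow_atTop two_ne_zero).eventually_gt_atTop (2 / η ^ 2)] with s ⟨w, hw, hlt⟩ hs hs2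
  rw [dist_eq_norm]
  refine lt_of_pow_lt_pow_left₀ 2 hη.le ?_
  rw [hDt hs, div_lt_iff₀ (by positivity)]
  rw [div_lt_iff₀ (by positivity)] at hs2
  have := (hc fun _ => s).2 w hw
  linarith

/-- The image of an arc with a tangent at infinity under a semialgebraic Lipschitz map has a tangent
at infinity. -/
theorem IsSemialgebraicArc.exists_tendsto_comp {γ : ℝ → EuclideanSpace ℝ (Fin n)} {ε : ℝ}
    (hγ : IsSemialgebraicArc γ ε) (hγX : ∀ t ∈ Ioi ε, γ t ∈ X)
    (hγv : Tendsto (fun t : ℝ => t⁻¹ • γ t) atTop (𝓝 v))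
    {h : EuclideanSpace ℝ (Fin n) → EuclideanSpace ℝ (Fin m)} (hh : IsSemialgebraicMapOn h X)
    {K : ℝ} (hlip : ∀ x ∈ X, ∀ x' ∈ X, ‖h x - h x'‖ ≤ K * ‖x - x'‖) :
    ∃ w, Tendsto (fun t : ℝ => t⁻¹ • h (γ t)) atTop (𝓝 w) := by
  have hbdd : IsBoundedUnder (· ≤ ·) atTop fun t : ℝ => ‖t⁻¹ • h (γ t)‖ := by
    set x₀ := γ (ε + 1)
    have h0 : x₀ ∈ X := hγX _ (by simp)
    have hlim : Tendsto (fun t : ℝ => t⁻¹ * ‖h x₀‖ + K * ‖t⁻¹ • γ t - t⁻¹ • x₀‖) atTop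
        (𝓝 (0 * ‖h x₀‖ + K * ‖v - (0 : ℝ) • x₀‖)) :=
      (tendsto_inv_atTop_zero.mul_const _).add
        ((hγv.sub (tendsto_inv_atTop_zero.smul_const _)).norm.const_mul _)
    refine hlim.isBoundedUnder_le.mono_le ?_
    filter_upwards [eventually_gt_atTop 0, eventually_gt_atTop ε] with t ht htε
    rw [← smul_sub, norm_smul, norm_smul, norm_inv, Real.norm_of_nonneg ht.le,
      mul_left_comm, ← mul_add]
    gcongr
    linarith [hlip _ (hγX t htε) _ h0, norm_le_norm_add_norm_sub' (h (γ t)) (h x₀)]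
  have hcoord : ∀ j, ∃ c, Tendsto (fun t : ℝ => (t⁻¹ • h (γ t)) j) atTop (𝓝 c) := by
    intro j
    have hle : ∀ t : ℝ, |(t⁻¹ • h (γ t)) j| ≤ ‖t⁻¹ • h (γ t)‖ := fun t =>
      PiLp.norm_apply_le (t⁻¹ • h (γ t)) j
    refine tendsto_of_no_upcrossings dense_univ ?_
      (hbdd.mono_le (.of_forall fun t => (le_abs_self _).trans (hle t))) ?_
    · rintro a - b - hab ⟨ha, hb⟩
      have hT : IsSemialgPred fun s : Unit → ℝ => ∃ w : Fin n → ℝ, ∃ u : Fin m → ℝ,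
          (ε < s () ∧ ∀ i, w i = γ (s ()) i) ∧
          (WithLp.toLp 2 w ∈ X ∧ ∀ i, u i = h (WithLp.toLp 2 w) i) ∧ u j < a * s () :=
        .exists_vec (.exists_vec (.and
          (.comp₂ (R := fun (s : Unit → ℝ) (w : Fin n → ℝ) => ε < s () ∧ ∀ i, w i = γ (s ()) i)
            hγ.isSemialgPred (f := fun z i => z (Sum.inl (Sum.inl i))) (by fun_prop) (by fun_prop))
          (.and (.comp₂ (R := fun (w : Fin n → ℝ) (u : Fin m → ℝ) => WithLp.toLp 2 w ∈ X ∧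
            ∀ i, u i = h (WithLp.toLp 2 w) i) hh.isSemialgPred (by fun_prop) (by fun_prop))
            (.lt (by fun_prop) (by fun_prop)))))
      have hiff : ∀ t, ε < t → 0 < t → ((∃ w : Fin n → ℝ, ∃ u : Fin m → ℝ,
          (ε < t ∧ ∀ i, w i = γ t i) ∧
          (WithLp.toLp 2 w ∈ X ∧ ∀ i, u i = h (WithLp.toLp 2 w) i) ∧ u j < a * t) ↔
          (t⁻¹ • h (γ t)) j < a) := by
        intro t htε ht
        rw [PiLp.smul_apply, smul_eq_mul, inv_mul_lt_iff₀ ht, mul_comm t]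
        constructor
        · rintro ⟨w, u, ⟨-, hw⟩, ⟨-, hu⟩, hlt⟩
          obtain rfl : w = WithLp.ofLp (γ t) := funext hw
          rwa [hu, WithLp.toLp_ofLp] at hlt
        · exact fun hlt => ⟨WithLp.ofLp (γ t), WithLp.ofLp (h (γ t)), ⟨htε, fun _ => rfl⟩,
            ⟨hγX t htε, fun _ => rfl⟩, hlt⟩
      rcases hT.eventually_atTop_or (T := fun t => ∃ w : Fin n → ℝ, ∃ u : Fin m → ℝ,
          (ε < t ∧ ∀ i, w i = γ t i) ∧
          (WithLp.toLp 2 w ∈ X ∧ ∀ i, u i = h (WithLp.toLp 2 w) i) ∧ u j < a * t) with h | h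
      · refine hb ?_
        filter_upwards [h, eventually_gt_atTop 0, eventually_gt_atTop ε] with t h1 h2 h3 h4
        exact (((hiff t h3 h2).1 h1).trans hab).not_gt h4
      · refine ha ?_
        filter_upwards [h, eventually_gt_atTop 0, eventually_gt_atTop ε] with t h1 h2 h3 h4
        exact h1 ((hiff t h3 h2).2 h4)
    · obtain ⟨b, hb⟩ := hbdd
      refine ⟨-b, ?_⟩
      rw [eventually_map] at hb ⊢
      filter_upwards [hb] with t ht
      linarith [neg_abs_le ((t⁻¹ • h (γ t)) j), hle t]
  choose c hc using hcoord
  exact ⟨WithLp.toLp 2 c, ((PiLp.continuous_toLp 2 _).tendsto c).comp (tendsto_pi_nhds.2 hc)⟩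

end Arcs

/-- the map `d_∞h` induced at infinity by a semialgebraic bi-Lipschitz bijection:
existence, uniqueness and bi-Lipschitz property. -/
theorem deriv_at_infinity {n m : ℕ}
    (X : Set (EuclideanSpace ℝ (Fin n))) (Y : Set (EuclideanSpace ℝ (Fin m)))
    (hX : IsSemialgebraic X) (hY : IsSemialgebraic Y)
    (hXu : ¬ Bornology.IsBounded X) (hYu : ¬ Bornology.IsBounded Y)
    (h : EuclideanSpace ℝ (Fin n) → EuclideanSpace ℝ (Fin m))
    (hbij : Set.BijOn h X Y) (hsa : IsSemialgebraicMapOn h X)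
    (K : ℝ) (hK1 : 1 ≤ K)
    (hbilip : ∀ x ∈ X, ∀ x' ∈ X,
      K⁻¹ * ‖x - x'‖ ≤ ‖h x - h x'‖ ∧ ‖h x - h x'‖ ≤ K * ‖x - x'‖) :
    ∃ g : EuclideanSpace ℝ (Fin n) → EuclideanSpace ℝ (Fin m),
      Set.BijOn g (tangConeInf X) (tangConeInf Y) ∧
      (∀ v ∈ tangConeInf X,
        (∀ (ε : ℝ) (γ : ℝ → EuclideanSpace ℝ (Fin n)), IsSemialgebraicArc γ ε →
          (∀ t ∈ Set.Ioi ε, γ t ∈ X) →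
          Filter.Tendsto (fun t : ℝ => t⁻¹ • (γ t - t • v)) Filter.atTop (nhds 0) →
          Filter.Tendsto (fun t : ℝ => t⁻¹ • (h (γ t) - t • g v)) Filter.atTop (nhds 0)) ∧
        ∀ w ∈ tangConeInf Y,
          (∀ (ε : ℝ) (γ : ℝ → EuclideanSpace ℝ (Fin n)), IsSemialgebraicArc γ ε →
            (∀ t ∈ Set.Ioi ε, γ t ∈ X) →
            Filter.Tendsto (fun t : ℝ => t⁻¹ • (γ t - t • v)) Filter.atTop (nhds 0) →
            Filter.Tendsto (fun t : ℝ => t⁻¹ • (h (γ t) - t • w)) Filter.atTop (nhds 0)) →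
          w = g v) ∧
      ∀ v₁ ∈ tangConeInf X, ∀ v₂ ∈ tangConeInf X,
        K⁻¹ * ‖v₁ - v₂‖ ≤ ‖g v₁ - g v₂‖ ∧ ‖g v₁ - g v₂‖ ≤ K * ‖v₁ - v₂‖ := by
  have hK : 0 < K := one_pos.trans_le hK1
  have harc : ∀ v : EuclideanSpace ℝ (Fin n), ∃ γ w, v ∈ tangConeInf X →
      (∃ ε, IsSemialgebraicArc γ ε) ∧ (∀ t, γ t ∈ X) ∧
        Tendsto (fun t : ℝ => t⁻¹ • γ t) atTop (𝓝 v) ∧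
        Tendsto (fun t : ℝ => t⁻¹ • h (γ t)) atTop (𝓝 w) := by
    intro v
    by_cases hv : v ∈ tangConeInf X
    · obtain ⟨ε, γ, hγ, hγX, hγv⟩ := hX.exists_arc hv
      obtain ⟨w, hw⟩ := hγ.exists_tendsto_comp (fun t _ => hγX t) hγv hsa
        fun x hx x' hx' => (hbilip x hx x' hx').2
      exact ⟨γ, w, fun _ => ⟨⟨ε, hγ⟩, hγX, hγv, hw⟩⟩
    · exact ⟨0, 0, fun h => (hv h).elim⟩
  choose γ g hg using harc
  have hscale : ∀ {t : ℝ}, 0 < t → ∀ x ∈ X, ∀ x' ∈ X,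
      K⁻¹ * ‖t⁻¹ • x - t⁻¹ • x'‖ ≤ ‖t⁻¹ • h x - t⁻¹ • h x'‖ ∧
        ‖t⁻¹ • h x - t⁻¹ • h x'‖ ≤ K * ‖t⁻¹ • x - t⁻¹ • x'‖ := by
    intro t ht x hx x' hx'
    have ht' : 0 ≤ t⁻¹ := (inv_pos.2 ht).le
    simp only [← smul_sub, norm_smul, Real.norm_of_nonneg ht', mul_left_comm _ t⁻¹]
    exact ⟨mul_le_mul_of_nonneg_left (hbilip x hx x' hx').1 ht',
      mul_le_mul_of_nonneg_left (hbilip x hx x' hx').2 ht'⟩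
  have hlim : ∀ v ∈ tangConeInf X, ∀ {α : Type} {l : Filter α} {x : α → EuclideanSpace ℝ (Fin n)}
      {t : α → ℝ}, (∀ᶠ i in l, x i ∈ X) → Tendsto t l atTop →
      Tendsto (fun i => (t i)⁻¹ • x i) l (𝓝 v) →
      Tendsto (fun i => (t i)⁻¹ • h (x i)) l (𝓝 (g v)) := by
    intro v hv α l x t hx ht hxv
    obtain ⟨-, hγX, hγ, hγ'⟩ := hg v hv
    have h0 : Tendsto (fun i => K * ‖(t i)⁻¹ • x i - (t i)⁻¹ • γ v (t i)‖) l (𝓝 0) := by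
      simpa using ((hxv.sub (hγ.comp ht)).norm.const_mul K)
    have h1 := squeeze_zero_norm' ((hx.and (ht.eventually_gt_atTop 0)).mono fun i hi =>
      (hscale hi.2 _ hi.1 _ (hγX (t i))).2) h0
    simpa using h1.add (hγ'.comp ht)
  have hbilip' : ∀ v₁ ∈ tangConeInf X, ∀ v₂ ∈ tangConeInf X,
      K⁻¹ * ‖v₁ - v₂‖ ≤ ‖g v₁ - g v₂‖ ∧ ‖g v₁ - g v₂‖ ≤ K * ‖v₁ - v₂‖ := by
    intro v₁ hv₁ v₂ hv₂
    obtain ⟨-, h₁X, h₁, h₁'⟩ := hg v₁ hv₁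
    obtain ⟨-, h₂X, h₂, h₂'⟩ := hg v₂ hv₂
    have hev := (eventually_gt_atTop 0).mono fun t ht => hscale ht _ (h₁X t) _ (h₂X t)
    exact ⟨le_of_tendsto_of_tendsto ((h₁.sub h₂).norm.const_mul _) (h₁'.sub h₂').norm
      (hev.mono fun t ht => ht.1), le_of_tendsto_of_tendsto (h₁'.sub h₂').norm
      ((h₁.sub h₂).norm.const_mul _) (hev.mono fun t ht => ht.2)⟩
  refine ⟨g, ⟨fun v hv => ?_, fun v₁ hv₁ v₂ hv₂ heq => ?_, fun w hw => ?_⟩, fun v hv =>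
    ⟨fun ε γ' _ hγX hγv => ?_, fun w _ hw => ?_⟩, hbilip'⟩
  · obtain ⟨-, hγX, -, hγ'⟩ := hg v hv
    exact mem_tangConeInf_of_arc hYu (.of_forall fun t => hbij.mapsTo (hγX t)) hγ'
  · have := (hbilip' v₁ hv₁ v₂ hv₂).1
    rw [heq, sub_self, norm_zero] at this
    exact sub_eq_zero.1 (norm_le_zero_iff.1 (nonpos_of_mul_nonpos_right this (inv_pos.2 hK)))
  · obtain ⟨y, t, hy, ht, htinf, hyw⟩ := exists_seq_of_mem_tangConeInf hw
    choose x hx hxy using fun i => hbij.surjOn (hy i)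
    have hbdd : IsBoundedUnder (· ≤ ·) atTop fun i => ‖(t i)⁻¹ • x i‖ := by
      have hlim₀ : Tendsto (fun i => K * ‖(t i)⁻¹ • y i - (t i)⁻¹ • h (x 0)‖ +
          ‖(t i)⁻¹ • x 0‖) atTop (𝓝 (K * ‖w - (0 : ℝ) • h (x 0)‖ + ‖(0 : ℝ) • x 0‖)) :=
        have hinv := tendsto_inv_atTop_zero.comp htinf
        ((hyw.sub (hinv.smul_const _)).norm.const_mul K).add (hinv.smul_const _).norm
      refine hlim₀.isBoundedUnder_le.mono_le (.of_forall fun i => ?_)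
      have h1 := (hscale (ht i) _ (hx i) _ (hx 0)).1
      rw [inv_mul_le_iff₀ hK, hxy i] at h1
      linarith [norm_le_norm_add_norm_sub' ((t i)⁻¹ • x i) ((t i)⁻¹ • x 0)]
    obtain ⟨R, hR⟩ := hbdd
    rw [eventually_map] at hR
    obtain ⟨v, -, φ, hφ, hv⟩ := tendsto_subseq_of_frequently_bounded
      (Metric.isBounded_closedBall (x := (0 : EuclideanSpace ℝ (Fin n))) (r := R))
      (hR.mono fun i hi => mem_closedBall_zero_iff.2 hi).frequently
    have htφ := htinf.comp hφ.tendsto_atTop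
    have hvX := mem_tangConeInf_of_seq hXu (fun i => hx (φ i)) (fun i => ht (φ i)) htφ hv
    refine ⟨v, hvX, tendsto_nhds_unique (hlim v hvX (.of_forall fun i => hx (φ i)) htφ hv) ?_⟩
    simpa only [hxy, Function.comp_def] using hyw.comp hφ.tendsto_atTop
  · rw [tendsto_inv_smul_sub_smul_iff] at hγv ⊢
    exact hlim v hv ((eventually_gt_atTop ε).mono hγX) tendsto_id hγv
  · obtain ⟨⟨ε, hγ⟩, hγX, hγv, hγ'⟩ := hg v hv
    exact tendsto_nhds_unique (tendsto_inv_smul_sub_smul_iff.1 (hw ε _ hγ (fun t _ => hγX t)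
      (tendsto_inv_smul_sub_smul_iff.2 hγv))) hγ'

end
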